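/- There exists an absolute constant C > 0 with the following property: for every σ > 0, every 1 ≤ p < ∞, every bounded continuous function f : ℝ² → ℂ whose Fourier transform (in the distributional sense) is supported in the closed disc {ξ ∈ ℝ² : |ξ| ≤ σ}, and all bounded normal operators N₁, N₂ on a complex Hilbert space H with N₁ − N₂ in the Schatten class S_p, the operator f(N₁) − f(N₂) belongs to S_p and ‖f(N₁) − f(N₂)‖_{S_p} ≤ C · σ · ‖f‖_{L∞} · ‖N₁ − N₂‖_{S_p}. -/

import Mathlib

open MeasureTheory Filter
open scoped FourierTransform

/-- Fourier transform of `f` (as a tempered distribution, identifying `ℝ²` with `ℂ`)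
is supported in the closed disc of radius `σ` centered at the origin. -/
def FourierSupportedIn (f : ℂ → ℂ) (σ : ℝ) : Prop :=
  ∀ φ : SchwartzMap ℂ ℂ, Disjoint (tsupport ⇑φ) (Metric.closedBall (0 : ℂ) σ) →
    ∫ x : ℂ, f x * 𝓕 (⇑φ) x = 0

/-- The `j`-th singular value (approximation number) of a bounded operator `T`:
the distance from `T` to the operators of rank at most `j`. -/
noncomputable def sNum {H : Type*} [NormedAddCommGroup H] [InnerProductSpace ℂ H]
    (T : H →L[ℂ] H) (j : ℕ) : ℝ :=
  sInf {c : ℝ | ∃ R : H →L[ℂ] H, LinearMap.rank (R : H →ₗ[ℂ] H) ≤ j ∧ c = ‖T - R‖}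

/-- `T` belongs to the Schatten–von Neumann class `S_p`. -/
def MemSchatten {H : Type*} [NormedAddCommGroup H] [InnerProductSpace ℂ H]
    (p : ℝ) (T : H →L[ℂ] H) : Prop :=
  Summable fun j : ℕ => sNum T j ^ p

/-- The Schatten `S_p` norm `(Σ_j s_j(T)^p)^{1/p}`. -/
noncomputable def schattenNorm {H : Type*} [NormedAddCommGroup H] [InnerProductSpace ℂ H]
    (p : ℝ) (T : H →L[ℂ] H) : ℝ :=
  (∑' j : ℕ, sNum T j ^ p) ^ (1 / p)

theorem sum_mul_nonneg_of_antitone {w d : ℕ → ℝ} (hw : Antitone w) (hw0 : ∀ j, 0 ≤ w j)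
    (hd : ∀ n, 0 ≤ ∑ j ∈ Finset.range n, d j) (n : ℕ) :
    0 ≤ ∑ j ∈ Finset.range n, w j * d j := by
  have key : ∀ n, w n * ∑ j ∈ Finset.range n, d j ≤ ∑ j ∈ Finset.range n, w j * d j := by
    intro n
    induction n with
    | zero => simp
    | succ n ih =>
      calc w (n + 1) * ∑ j ∈ Finset.range (n + 1), d j
          ≤ w n * ∑ j ∈ Finset.range (n + 1), d j :=
            mul_le_mul_of_nonneg_right (hw n.le_succ) (hd _)
        _ ≤ _ := by
            rw [Finset.sum_range_succ, Finset.sum_range_succ, mul_add]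
            linarith
  exact (mul_nonneg (hw0 n) (hd n)).trans (key n)

theorem sum_rpow_le_of_weak_majorization {x y : ℕ → ℝ} {K p : ℝ} (hp : 1 ≤ p) (hK : 0 ≤ K)
    (hx : ∀ j, 0 ≤ x j) (hy : ∀ j, 0 ≤ y j) (hya : Antitone y)
    (h : ∀ n, ∑ j ∈ Finset.range n, y j ≤ K * ∑ j ∈ Finset.range n, x j) (n : ℕ) :
    ∑ j ∈ Finset.range n, y j ^ p ≤ K ^ p * ∑ j ∈ Finset.range n, x j ^ p := by
  rcases hp.eq_or_lt with rfl | hp1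
  · simpa using h n
  set S := ∑ j ∈ Finset.range n, y j ^ p with hS
  set X := ∑ j ∈ Finset.range n, x j ^ p with hX
  have hS0 : 0 ≤ S := Finset.sum_nonneg fun j _ => Real.rpow_nonneg (hy j) _
  have hX0 : 0 ≤ X := Finset.sum_nonneg fun j _ => Real.rpow_nonneg (hx j) _
  have hp0 : 0 < p := by linarith
  obtain ⟨q, hpq⟩ : ∃ q : ℝ, p.HolderConjugate q := ⟨_, Real.HolderConjugate.conjExponent hp1⟩
  have abel : S ≤ K * ∑ j ∈ Finset.range n, x j * y j ^ (p - 1) := by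
    have := sum_mul_nonneg_of_antitone (w := fun j => y j ^ (p - 1))
      (d := fun j => K * x j - y j)
      (fun i j hij => Real.rpow_le_rpow (hy j) (hya hij) (by linarith))
      (fun j => Real.rpow_nonneg (hy j) _)
      (fun m => by
        rw [Finset.sum_sub_distrib, ← Finset.mul_sum]
        linarith [h m]) n
    have e : ∑ j ∈ Finset.range n, y j ^ (p - 1) * (K * x j - y j)
        = K * (∑ j ∈ Finset.range n, x j * y j ^ (p - 1)) - S := by
      rw [Finset.mul_sum, hS, ← Finset.sum_sub_distrib]
      refine Finset.sum_congr rfl fun j _ => ?_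
      have : y j ^ p = y j ^ (p - 1) * y j := by
        conv_lhs => rw [show p = (p - 1) + 1 by ring]
        rw [Real.rpow_add_one' (hy j) (by linarith)]
      rw [this]
      ring
    linarith
  have holder : ∑ j ∈ Finset.range n, x j * y j ^ (p - 1) ≤ X ^ (1 / p) * S ^ (1 / q) := by
    have := Real.inner_le_Lp_mul_Lq_of_nonneg (Finset.range n) hpq
      (f := x) (g := fun j => y j ^ (p - 1)) (fun j _ => hx j)
      (fun j _ => Real.rpow_nonneg (hy j) _)
    have e : ∀ j, (y j ^ (p - 1)) ^ q = y j ^ p := fun j => by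
      rw [← Real.rpow_mul (hy j), hpq.sub_one_mul_conj]
    simpa [e] using this
  rcases hS0.eq_or_lt with h0 | hSpos
  · rw [← h0]
    positivity
  have h1 : S ≤ K * (X ^ (1 / p) * S ^ (1 / q)) :=
    abel.trans (mul_le_mul_of_nonneg_left holder hK)
  have h2 : S ^ (1 / p) * S ^ (1 / q) = S := by
    rw [← Real.rpow_add hSpos]
    have := hpq.inv_add_inv_eq_one
    rw [one_div, one_div, this, Real.rpow_one]
  have h3 : S ^ (1 / p) ≤ K * X ^ (1 / p) := by
    have hq : 0 < S ^ (1 / q) := Real.rpow_pos_of_pos hSpos _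
    refine le_of_mul_le_mul_right ?_ hq
    rw [h2]
    linarith
  have h4 := Real.rpow_le_rpow (Real.rpow_nonneg hS0 _) h3 hp0.le
  rwa [Real.mul_rpow hK (Real.rpow_nonneg hX0 _), ← Real.rpow_mul hS0, ← Real.rpow_mul hX0,
    one_div_mul_cancel hp0.ne', Real.rpow_one, Real.rpow_one] at h4

theorem summable_rpow_of_weak_majorization {x y : ℕ → ℝ} {K p : ℝ} (hp : 1 ≤ p) (hK : 0 ≤ K)
    (hx : ∀ j, 0 ≤ x j) (hy : ∀ j, 0 ≤ y j) (hya : Antitone y)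
    (h : ∀ n, ∑ j ∈ Finset.range n, y j ≤ K * ∑ j ∈ Finset.range n, x j)
    (hs : Summable fun j => x j ^ p) :
    (Summable fun j => y j ^ p) ∧
      (∑' j, y j ^ p) ^ (1 / p) ≤ K * (∑' j, x j ^ p) ^ (1 / p) := by
  have hp0 : 0 < p := by linarith
  have hx' : ∀ j, 0 ≤ x j ^ p := fun j => Real.rpow_nonneg (hx j) _
  have hy' : ∀ j, 0 ≤ y j ^ p := fun j => Real.rpow_nonneg (hy j) _
  have hb : ∀ n, ∑ j ∈ Finset.range n, y j ^ p ≤ K ^ p * ∑' j, x j ^ p := fun n =>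
    (sum_rpow_le_of_weak_majorization hp hK hx hy hya h n).trans
      (mul_le_mul_of_nonneg_left (hs.sum_le_tsum _ fun j _ => hx' j) (by positivity))
  refine ⟨summable_of_sum_range_le hy' hb, ?_⟩
  have h1 := Real.tsum_le_of_sum_range_le hy' hb
  have h2 := Real.rpow_le_rpow (tsum_nonneg hy') h1 (by positivity : (0 : ℝ) ≤ 1 / p)
  rwa [Real.mul_rpow (by positivity) (tsum_nonneg hx'), ← Real.rpow_mul hK,
    mul_one_div_cancel hp0.ne', Real.rpow_one] at h2

section SingularNumbers

open scoped InnerProductSpace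

variable {H : Type*} [NormedAddCommGroup H] [InnerProductSpace ℂ H]

theorem sNum_set_bddBelow (T : H →L[ℂ] H) (j : ℕ) :
    BddBelow {c : ℝ | ∃ R : H →L[ℂ] H, LinearMap.rank (R : H →ₗ[ℂ] H) ≤ j ∧ c = ‖T - R‖} :=
  ⟨0, by rintro c ⟨R, -, rfl⟩; exact norm_nonneg _⟩

theorem sNum_set_nonempty (T : H →L[ℂ] H) (j : ℕ) :
    {c : ℝ | ∃ R : H →L[ℂ] H,
      LinearMap.rank (R : H →ₗ[ℂ] H) ≤ j ∧ c = ‖T - R‖}.Nonempty :=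
  ⟨_, 0, by simp, rfl⟩

theorem sNum_nonneg (T : H →L[ℂ] H) (j : ℕ) : 0 ≤ sNum T j :=
  Real.sInf_nonneg (by rintro c ⟨R, -, rfl⟩; exact norm_nonneg _)

theorem sNum_le_norm_sub {T R : H →L[ℂ] H} {j : ℕ} (hR : LinearMap.rank (R : H →ₗ[ℂ] H) ≤ j) :
    sNum T j ≤ ‖T - R‖ :=
  csInf_le (sNum_set_bddBelow T j) ⟨R, hR, rfl⟩

theorem exists_rank_le_norm_sub_lt (T : H →L[ℂ] H) (j : ℕ) {ε : ℝ} (hε : 0 < ε) :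
    ∃ R : H →L[ℂ] H, LinearMap.rank (R : H →ₗ[ℂ] H) ≤ j ∧ ‖T - R‖ < sNum T j + ε := by
  obtain ⟨c, ⟨R, hR, rfl⟩, hc⟩ := Real.lt_sInf_add_pos (sNum_set_nonempty T j) hε
  exact ⟨R, hR, hc⟩

theorem sNum_antitone (T : H →L[ℂ] H) : Antitone (sNum T) := fun i j hij =>
  csInf_le_csInf (sNum_set_bddBelow T j) (sNum_set_nonempty T i) (by
    rintro c ⟨R, hR, rfl⟩
    exact ⟨R, hR.trans (by exact_mod_cast hij), rfl⟩)

theorem sNum_le_norm (T : H →L[ℂ] H) (j : ℕ) : sNum T j ≤ ‖T‖ := by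
  simpa using sNum_le_norm_sub (T := T) (R := 0) (j := j) (by simp)

theorem rank_add_le_of_le {S R : H →L[ℂ] H} {j k : ℕ}
    (hS : LinearMap.rank (S : H →ₗ[ℂ] H) ≤ j) (hR : LinearMap.rank (R : H →ₗ[ℂ] H) ≤ k) :
    LinearMap.rank ((S + R : H →L[ℂ] H) : H →ₗ[ℂ] H) ≤ (j + k : ℕ) := by
  push_cast
  exact (LinearMap.rank_add_le _ _).trans (add_le_add hS hR)

theorem rank_sub_le_of_le {S R : H →L[ℂ] H} {j k : ℕ}
    (hS : LinearMap.rank (S : H →ₗ[ℂ] H) ≤ j) (hR : LinearMap.rank (R : H →ₗ[ℂ] H) ≤ k) :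
    LinearMap.rank ((S - R : H →L[ℂ] H) : H →ₗ[ℂ] H) ≤ (j + k : ℕ) := by
  rw [sub_eq_add_neg]
  refine rank_add_le_of_le hS ?_
  have : ((-R : H →L[ℂ] H) : H →ₗ[ℂ] H) = (-LinearMap.id) ∘ₗ (R : H →ₗ[ℂ] H) := by
    ext; simp
  rw [this]
  exact (LinearMap.rank_comp_le_right _ _).trans hR

theorem sNum_add_le {T T' : H →L[ℂ] H} {k : ℕ}
    (h : LinearMap.rank ((T - T' : H →L[ℂ] H) : H →ₗ[ℂ] H) ≤ k) (j : ℕ) :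
    sNum T (j + k) ≤ sNum T' j := by
  refine le_of_forall_pos_le_add fun ε hε => ?_
  obtain ⟨R, hR, hlt⟩ := exists_rank_le_norm_sub_lt T' j hε
  have := sNum_le_norm_sub (T := T) (rank_add_le_of_le hR h)
  rw [show T - (R + (T - T')) = T' - R by abel] at this
  exact this.trans hlt.le

/-- A subadditive functional controlled by `M · min(n, rank) · ‖·‖` is controlled by the
sum of the first `n` singular values. -/
theorem le_sum_sNum_of_subadditive {ℓ : (H →L[ℂ] H) → ℝ} {M : ℝ} (hM : 0 ≤ M) {n : ℕ}
    (hadd : ∀ Y Z, ℓ (Y + Z) ≤ ℓ Y + ℓ Z) (hn : ∀ Y, ℓ Y ≤ M * (n * ‖Y‖))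
    (hr : ∀ (r : ℕ) (Y : H →L[ℂ] H), LinearMap.rank (Y : H →ₗ[ℂ] H) ≤ r → ℓ Y ≤ M * (r * ‖Y‖))
    (X : H →L[ℂ] H) :
    ℓ X ≤ 13 * M * ∑ j ∈ Finset.range n, sNum X j := by
  rcases Nat.eq_zero_or_pos n with rfl | hn0
  · simpa using hn X
  have main : ∀ ε : ℝ, 0 < ε →
      ℓ X ≤ 13 * M * (∑ j ∈ Finset.range n, sNum X j + n * ε) := by
    intro ε hε
    choose R hR hRX using fun j => exists_rank_le_norm_sub_lt X j hε
    have hdiff : ∀ i j, i ≤ j → ℓ (R j) ≤ ℓ (R i) + M * ((j + i : ℕ) * (2 * (sNum X i + ε))) := by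
      intro i j hij
      have h1 := hadd (R i) (R j - R i)
      rw [add_sub_cancel] at h1
      have h2 := hr (j + i) _ (rank_sub_le_of_le (hR j) (hR i))
      have h3 : ‖R j - R i‖ ≤ 2 * (sNum X i + ε) := by
        calc ‖R j - R i‖ = ‖(X - R i) - (X - R j)‖ := by congr 1; abel
          _ ≤ ‖X - R i‖ + ‖X - R j‖ := norm_sub_le _ _
          _ ≤ _ := by linarith [hRX i, hRX j, sNum_antitone X hij]
      have h4 : M * (((j + i : ℕ) : ℝ) * ‖R j - R i‖) ≤
          M * ((j + i : ℕ) * (2 * (sNum X i + ε))) := by gcongr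
      linarith
    have dy : ∀ k : ℕ, ℓ (R (2 ^ (k + 1))) ≤
        12 * M * (∑ j ∈ Finset.range (2 ^ k), sNum X j + (2 ^ k : ℕ) * ε) := by
      intro k
      induction k with
      | zero =>
        have h0 : ℓ (R 0) ≤ 0 := by simpa using hr 0 _ (hR 0)
        have h1 := hdiff 0 2 (by norm_num)
        have h2 : 0 ≤ M * (sNum X 0 + ε) := mul_nonneg hM (add_nonneg (sNum_nonneg _ _) hε.le)
        norm_num at h1 ⊢
        linarith
      | succ k ih =>
        have h1 := hdiff (2 ^ (k + 1)) (2 ^ (k + 1 + 1)) (Nat.pow_le_pow_right (by norm_num) (by lia))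
        have h2 : (2 ^ k : ℕ) * sNum X (2 ^ (k + 1)) ≤
            ∑ j ∈ Finset.Ico (2 ^ k) (2 ^ (k + 1)), sNum X j := by
          have := Finset.card_nsmul_le_sum (Finset.Ico (2 ^ k) (2 ^ (k + 1))) (sNum X)
            (sNum X (2 ^ (k + 1))) (fun j hj => sNum_antitone X (Finset.mem_Ico.1 hj).2.le)
          rw [Nat.card_Ico, show 2 ^ (k + 1) - 2 ^ k = 2 ^ k by rw [pow_succ]; lia,
            nsmul_eq_mul] at this
          exact this
        have h3 := Finset.sum_range_add_sum_Ico (sNum X)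
          (Nat.pow_le_pow_right (n := 2) (by norm_num) k.le_succ)
        rw [← h3]
        have h4 := mul_le_mul_of_nonneg_left h2 hM
        push_cast [pow_succ] at h1 h4 ih ⊢
        linarith
    obtain ⟨k, hk1, hk2⟩ : ∃ k, 2 ^ k ≤ n ∧ n < 2 ^ (k + 1) :=
      ⟨Nat.log 2 n, Nat.pow_log_le_self 2 hn0.ne', Nat.lt_pow_succ_log_self (by norm_num) n⟩
    have h1 := hadd (X - R (2 ^ (k + 1))) (R (2 ^ (k + 1)))
    rw [sub_add_cancel] at h1
    have h2 : ℓ (X - R (2 ^ (k + 1))) ≤ M * (n * (sNum X (2 ^ (k + 1)) + ε)) :=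
      (hn _).trans (by gcongr; exact (hRX _).le)
    have h3 : n * sNum X (2 ^ (k + 1)) ≤ ∑ j ∈ Finset.range n, sNum X j := by
      have := Finset.card_nsmul_le_sum (Finset.range n) (sNum X)
        (sNum X (2 ^ (k + 1)))
        (fun j hj => sNum_antitone X ((Finset.mem_range.1 hj).trans hk2).le)
      simpa using this
    have h4 : ∑ j ∈ Finset.range (2 ^ k), sNum X j ≤ ∑ j ∈ Finset.range n, sNum X j :=
      Finset.sum_le_sum_of_subset_of_nonneg (Finset.range_mono hk1) fun j _ _ => sNum_nonneg X j
    have h5 : ((2 ^ k : ℕ) : ℝ) * ε ≤ n * ε := by gcongr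
    have h6 := dy k
    have h7 := mul_le_mul_of_nonneg_left h3 hM
    have h8 := mul_le_mul_of_nonneg_left h4 hM
    have h9 := mul_le_mul_of_nonneg_left h5 hM
    linarith
  refine le_of_forall_pos_le_add fun δ hδ => ?_
  have hpos : 0 < 13 * M * n + 1 := by positivity
  have := main (δ / (13 * M * n + 1)) (by positivity)
  have h2 : 13 * M * n * (δ / (13 * M * n + 1)) ≤ δ := by
    rw [mul_div_assoc', div_le_iff₀ hpos]
    nlinarith
  linarith

/-- A finite family satisfying Bessel's inequality. -/
def IsBessel {n : ℕ} (u : Fin n → H) : Prop :=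
  ∀ x : H, ∑ j, ‖⟪u j, x⟫_ℂ‖ ^ 2 ≤ ‖x‖ ^ 2

theorem isBessel_zero (n : ℕ) : IsBessel (fun _ : Fin n => (0 : H)) := fun x => by
  simp

theorem IsBessel.norm_le {n : ℕ} {u : Fin n → H} (hu : IsBessel u) (j : Fin n) : ‖u j‖ ≤ 1 := by
  have h1 := (Finset.single_le_sum (f := fun i => ‖⟪u i, u j⟫_ℂ‖ ^ 2)
    (fun i _ => by positivity) (Finset.mem_univ j)).trans (hu (u j))
  have h2 : ‖⟪u j, u j⟫_ℂ‖ = ‖u j‖ ^ 2 := by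
    rw [inner_self_eq_norm_sq_to_K]; simp
  rw [h2] at h1
  by_contra! h
  have h3 : 1 < ‖u j‖ ^ 2 := one_lt_pow₀ h two_ne_zero
  nlinarith

theorem IsBessel.cons {n : ℕ} {u : Fin n → H} (hu : IsBessel u) {e : H} (he : ‖e‖ = 1) :
    IsBessel (Fin.cons e fun j => u j - ⟪e, u j⟫_ℂ • e : Fin (n + 1) → H) := by
  intro x
  rw [Fin.sum_univ_succ]
  simp only [Fin.cons_zero, Fin.cons_succ]
  have h1 : ∀ j, ⟪u j - ⟪e, u j⟫_ℂ • e, x⟫_ℂ = ⟪u j, x - ⟪e, x⟫_ℂ • e⟫_ℂ := fun j => by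
    rw [inner_sub_left, inner_sub_right, inner_smul_left, inner_smul_right, inner_conj_symm]
    ring
  simp only [h1]
  have h2 : ‖x‖ ^ 2 = ‖⟪e, x⟫_ℂ‖ ^ 2 + ‖x - ⟪e, x⟫_ℂ • e‖ ^ 2 := by
    have h3 : ⟪⟪e, x⟫_ℂ • e, x - ⟪e, x⟫_ℂ • e⟫_ℂ = 0 := by
      rw [inner_sub_right, inner_smul_left, inner_smul_left, inner_smul_right,
        inner_self_eq_norm_sq_to_K, he]
      simp
    have := norm_add_sq_eq_norm_sq_add_norm_sq_of_inner_eq_zero _ _ h3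
    rw [add_sub_cancel, norm_smul, he] at this
    nlinarith
  rw [h2]
  linarith [hu (x - ⟪e, x⟫_ℂ • e)]

theorem exists_unit_le_two_mul_re_inner {T : H →L[ℂ] H} (hT : T ≠ 0) :
    ∃ e g : H, ‖e‖ = 1 ∧ ‖g‖ = 1 ∧ ‖T‖ ≤ 2 * (⟪g, T e⟫_ℂ).re := by
  have hpos : 0 < ‖T‖ := norm_pos_iff.2 hT
  obtain ⟨x, hx⟩ : ∃ x, ‖T‖ / 2 * ‖x‖ < ‖T x‖ := by
    by_contra! h
    have := T.opNorm_le_bound (by positivity) h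
    linarith
  have hTx : 0 < ‖T x‖ := lt_of_le_of_lt (by positivity) hx
  have hx0 : 0 < ‖x‖ := by
    rw [norm_pos_iff]
    rintro rfl
    simp at hTx
  refine ⟨((‖x‖⁻¹ : ℝ) : ℂ) • x, ((‖T x‖⁻¹ : ℝ) : ℂ) • T x, ?_, ?_, ?_⟩
  · rw [norm_smul]
    simp [hx0.ne']
  · rw [norm_smul]
    simp [norm_pos_iff.1 hTx]
  · have hin : ⟪T x, T x⟫_ℂ = ((‖T x‖ ^ 2 : ℝ) : ℂ) := by
      rw [inner_self_eq_norm_sq_to_K]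
      simp
    rw [map_smul, inner_smul_left, inner_smul_right, Complex.conj_ofReal, hin,
      ← Complex.ofReal_mul, ← Complex.ofReal_mul, Complex.ofReal_re]
    have : ‖T x‖⁻¹ * (‖x‖⁻¹ * ‖T x‖ ^ 2) = ‖T x‖ / ‖x‖ := by
      field_simp
    rw [this]
    have : ‖T‖ / 2 < ‖T x‖ / ‖x‖ := by rwa [lt_div_iff₀ hx0]
    linarith

theorem rank_smulRight_le (φ : H →L[ℂ] ℂ) (e : H) :
    LinearMap.rank ((φ.smulRight e : H →L[ℂ] H) : H →ₗ[ℂ] H) ≤ (1 : ℕ) := by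
  have h : LinearMap.range ((φ.smulRight e : H →L[ℂ] H) : H →ₗ[ℂ] H) ≤
      Submodule.span ℂ {e} := by
    rintro _ ⟨x, rfl⟩
    exact Submodule.mem_span_singleton.2 ⟨φ x, by simp⟩
  exact (Submodule.rank_mono h).trans ((rank_span_le _).trans (by simp))

theorem exists_isBessel_sum_sNum_le (n : ℕ) (T : H →L[ℂ] H) :
    ∃ u v : Fin n → H, IsBessel u ∧ IsBessel v ∧
      ∑ j ∈ Finset.range n, sNum T (2 * j) ≤ 2 * (∑ j, ⟪v j, T (u j)⟫_ℂ).re := by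
  induction n generalizing T with
  | zero => exact ⟨fun _ => 0, fun _ => 0, isBessel_zero _, isBessel_zero _, by simp⟩
  | succ n ih =>
    rcases eq_or_ne T 0 with rfl | hT
    · refine ⟨fun _ => 0, fun _ => 0, isBessel_zero _, isBessel_zero _, ?_⟩
      simpa using Finset.sum_nonpos
        fun j (_ : j ∈ Finset.range (n + 1)) => by simpa using sNum_le_norm (0 : H →L[ℂ] H) (2 * j)
    obtain ⟨e, g, he, hg, heg⟩ := exists_unit_le_two_mul_re_inner hT
    set P : H →L[ℂ] H := (innerSL ℂ e).smulRight e with hP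
    set Q : H →L[ℂ] H := (innerSL ℂ g).smulRight g with hQ
    obtain ⟨u, v, hu, hv, huv⟩ := ih ((1 - Q) * T * (1 - P))
    refine ⟨_, _, hu.cons he, hv.cons hg, ?_⟩
    rw [Fin.sum_univ_succ, Finset.sum_range_succ']
    simp only [Fin.cons_zero, Fin.cons_succ, Complex.add_re]
    have h1 : ∀ j, ⟪v j - ⟪g, v j⟫_ℂ • g, T (u j - ⟪e, u j⟫_ℂ • e)⟫_ℂ =
        ⟪v j, ((1 - Q) * T * (1 - P)) (u j)⟫_ℂ := fun j => by
      simp only [hP, hQ, mul_apply_eq_comp, sub_apply,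
        one_apply_eq_self, ContinuousLinearMap.smulRight_apply, innerSL_apply_apply]
      rw [inner_sub_left, inner_sub_right, inner_smul_left, inner_smul_right, inner_conj_symm]
      ring
    simp only [h1]
    have hrank : LinearMap.rank ((T - (1 - Q) * T * (1 - P) : H →L[ℂ] H) : H →ₗ[ℂ] H) ≤
        (2 : ℕ) := by
      have : T - (1 - Q) * T * (1 - P) = Q * T + ((1 - Q) * T) * P := by noncomm_ring
      rw [this]
      exact rank_add_le_of_le (j := 1) (k := 1)
        ((LinearMap.rank_comp_le_left (T : H →ₗ[ℂ] H) (Q : H →ₗ[ℂ] H)).trans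
          (rank_smulRight_le _ _))
        ((LinearMap.rank_comp_le_right (P : H →ₗ[ℂ] H) (((1 - Q) * T : H →L[ℂ] H) :
          H →ₗ[ℂ] H)).trans (rank_smulRight_le _ _))
    have h2 : ∑ j ∈ Finset.range n, sNum T (2 * (j + 1)) ≤
        ∑ j ∈ Finset.range n, sNum ((1 - Q) * T * (1 - P)) (2 * j) :=
      Finset.sum_le_sum fun j _ => sNum_add_le hrank (2 * j)
    have h3 := sNum_le_norm T (2 * 0)
    linarith

theorem exists_isBessel_sum_sNum_le_four (n : ℕ) (T : H →L[ℂ] H) :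
    ∃ u v : Fin n → H, IsBessel u ∧ IsBessel v ∧
      ∑ j ∈ Finset.range n, sNum T j ≤ 4 * ‖∑ j, ⟪v j, T (u j)⟫_ℂ‖ := by
  obtain ⟨u, v, hu, hv, h⟩ := exists_isBessel_sum_sNum_le n T
  refine ⟨u, v, hu, hv, ?_⟩
  have h1 : ∀ n, ∑ j ∈ Finset.range (2 * n), sNum T j ≤
      2 * ∑ j ∈ Finset.range n, sNum T (2 * j) := by
    intro n
    induction n with
    | zero => simp
    | succ n ih =>
      rw [show 2 * (n + 1) = 2 * n + 1 + 1 by ring, Finset.sum_range_succ, Finset.sum_range_succ,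
        Finset.sum_range_succ]
      linarith [sNum_antitone T (2 * n).le_succ]
  have h2 : ∑ j ∈ Finset.range n, sNum T j ≤ ∑ j ∈ Finset.range (2 * n), sNum T j :=
    Finset.sum_le_sum_of_subset_of_nonneg (Finset.range_mono (by lia))
      fun j _ _ => sNum_nonneg T j
  linarith [h1 n, Complex.re_le_norm (∑ j, ⟪v j, T (u j)⟫_ℂ)]

end SingularNumbers

section SchurMaps

open scoped InnerProductSpace

variable {H : Type*} [NormedAddCommGroup H] [InnerProductSpace ℂ H]

/-- The trace-like pairing `T ↦ ∑ j, ⟪v j, T (u j)⟫`. -/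
noncomputable def pairing {n : ℕ} (u v : Fin n → H) : (H →L[ℂ] H) →ₗ[ℂ] ℂ where
  toFun T := ∑ j, ⟪v j, T (u j)⟫_ℂ
  map_add' S T := by simp [Finset.sum_add_distrib]
  map_smul' c T := by simp [Finset.mul_sum]

theorem pairing_apply {n : ℕ} (u v : Fin n → H) (T : H →L[ℂ] H) :
    pairing u v T = ∑ j, ⟪v j, T (u j)⟫_ℂ := rfl

theorem norm_pairing_le {n : ℕ} {u v : Fin n → H} (hu : IsBessel u) (hv : IsBessel v)
    (T : H →L[ℂ] H) : ‖pairing u v T‖ ≤ n * ‖T‖ := by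
  have h : ∀ j ∈ Finset.univ, ‖⟪v j, T (u j)⟫_ℂ‖ ≤ ‖T‖ := fun j _ =>
    calc ‖⟪v j, T (u j)⟫_ℂ‖ ≤ ‖v j‖ * ‖T (u j)‖ := norm_inner_le_norm _ _
      _ ≤ 1 * (‖T‖ * ‖u j‖) := by
          gcongr
          · exact hv.norm_le j
          · exact T.le_opNorm _
      _ ≤ 1 * (‖T‖ * 1) := by gcongr; exact hu.norm_le j
      _ = ‖T‖ := by ring
  simpa [pairing_apply] using norm_sum_le_of_le _ h

theorem sum_mul_le_of_sum_sq_le {ι : Type*} [Fintype ι] {x y : ι → ℝ} {X Y : ℝ} (hX : 0 ≤ X)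
    (hY : 0 ≤ Y) (hx : ∑ i, x i ^ 2 ≤ X ^ 2) (hy : ∑ i, y i ^ 2 ≤ Y ^ 2) :
    ∑ i, x i * y i ≤ X * Y := by
  refine (Real.sum_mul_le_sqrt_mul_sqrt _ x y).trans ?_
  exact mul_le_mul (Real.sqrt_le_iff.2 ⟨hX, hx⟩) (Real.sqrt_le_iff.2 ⟨hY, hy⟩)
    (Real.sqrt_nonneg _) hX

theorem exists_sum_rankOne {Y : H →L[ℂ] H} [CompleteSpace H] {r : ℕ}
    (hY : LinearMap.rank (Y : H →ₗ[ℂ] H) ≤ r) :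
    ∃ (d : ℕ) (x y : Fin d → H), d ≤ r ∧ (∀ l, ‖x l‖ ≤ 1) ∧ (∀ l, ‖y l‖ ≤ ‖Y‖) ∧
      ∀ z, Y z = ∑ l, ⟪y l, z⟫_ℂ • x l := by
  set S := LinearMap.range (Y : H →ₗ[ℂ] H) with hS
  have hfin : FiniteDimensional ℂ S :=
    Module.rank_lt_aleph0_iff.1 (lt_of_le_of_lt hY (Cardinal.natCast_lt_aleph0))
  let b := stdOrthonormalBasis ℂ S
  have hb : ∀ l, ‖(b l : H)‖ = 1 := fun l => by
    exact b.orthonormal.1 l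
  refine ⟨Module.finrank ℂ S, fun l => b l, fun l => ContinuousLinearMap.adjoint Y (b l),
    ?_, fun l => (hb l).le, fun l => ?_, fun z => ?_⟩
  · exact Module.finrank_le_of_rank_le hY
  · have := (ContinuousLinearMap.adjoint Y).le_opNorm (b l)
    rwa [hb, mul_one, LinearIsometryEquiv.norm_map] at this
  · have hz : Y z ∈ S := ⟨z, rfl⟩
    have := congrArg (Subtype.val) (b.sum_repr' ⟨Y z, hz⟩)
    simp only [ContinuousLinearMap.adjoint_inner_left]
    simpa [Submodule.coe_inner] using this.symm

theorem adjoint_apply_of_sum_rankOne [CompleteSpace H] {Y : H →L[ℂ] H} {d : ℕ} {x y : Fin d → H}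
    (h : ∀ z, Y z = ∑ l, ⟪y l, z⟫_ℂ • x l) (z : H) :
    ContinuousLinearMap.adjoint Y z = ∑ l, ⟪x l, z⟫_ℂ • y l := by
  refine ext_inner_left ℂ fun w => ?_
  rw [ContinuousLinearMap.adjoint_inner_right, h, sum_inner, inner_sum]
  refine Finset.sum_congr rfl fun l _ => ?_
  rw [inner_smul_left, inner_smul_right, inner_conj_symm]
  ring

/-- The discretised double operator integral with symbol `m`. -/
noncomputable def schurMap {ι κ : Type*} [Fintype ι] [Fintype κ] (m : ι → κ → ℂ)
    (P : ι → H →L[ℂ] H) (Q : κ → H →L[ℂ] H) : (H →L[ℂ] H) →ₗ[ℂ] (H →L[ℂ] H) where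
  toFun Y := ∑ i, ∑ j, m i j • (P i * Y * Q j)
  map_add' Y Z := by simp [mul_add, add_mul, Finset.sum_add_distrib]
  map_smul' c Y := by
    simp only [Finset.smul_sum, RingHom.id_apply, mul_smul_comm, smul_mul_assoc]
    exact Finset.sum_congr rfl fun i _ => Finset.sum_congr rfl fun j _ => smul_comm _ _ _

theorem schurMap_apply {ι κ : Type*} [Fintype ι] [Fintype κ] (m : ι → κ → ℂ)
    (P : ι → H →L[ℂ] H) (Q : κ → H →L[ℂ] H) (Y : H →L[ℂ] H) :
    schurMap m P Q Y = ∑ i, ∑ j, m i j • (P i * Y * Q j) := rfl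

variable [CompleteSpace H]

/-- The row and the column with entries `a k` have norm at most `A`. -/
def IsSquareBounded {κ : Type*} [Fintype κ] (a : κ → H →L[ℂ] H) (A : ℝ) : Prop :=
  (∀ x, ∑ k, ‖a k x‖ ^ 2 ≤ (A * ‖x‖) ^ 2) ∧
    ∀ x, ∑ k, ‖ContinuousLinearMap.adjoint (a k) x‖ ^ 2 ≤ (A * ‖x‖) ^ 2

theorem norm_sum_mul_mul_le {κ : Type*} [Fintype κ] {a b : κ → H →L[ℂ] H} {A B : ℝ}
    (hA : 0 ≤ A) (hB : 0 ≤ B) (ha : IsSquareBounded a A) (hb : IsSquareBounded b B)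
    (Y : H →L[ℂ] H) : ‖∑ k, a k * Y * b k‖ ≤ A * B * ‖Y‖ := by
  refine ContinuousLinearMap.opNorm_le_bound _ (by positivity) fun u => ?_
  set w := (∑ k, a k * Y * b k) u with hw
  have h1 : ‖w‖ * ‖w‖ ≤ (A * ‖w‖) * (‖Y‖ * (B * ‖u‖)) := by
    have e : ‖w‖ * ‖w‖ = ‖⟪w, w⟫_ℂ‖ := by
      rw [inner_self_eq_norm_sq_to_K]
      simp [sq]
    rw [e]
    nth_rewrite 2 [hw]
    rw [sum_apply, inner_sum]
    calc ‖∑ k, ⟪w, (a k * Y * b k) u⟫_ℂ‖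
        ≤ ∑ k, ‖ContinuousLinearMap.adjoint (a k) w‖ * (‖Y‖ * ‖b k u‖) := by
          refine norm_sum_le_of_le _ fun k _ => ?_
          rw [mul_apply_eq_comp, mul_apply_eq_comp, ← ContinuousLinearMap.adjoint_inner_left]
          exact (norm_inner_le_norm _ _).trans (by gcongr; exact Y.le_opNorm _)
      _ ≤ _ := by
          refine sum_mul_le_of_sum_sq_le (by positivity) (by positivity) (ha.2 w) ?_
          simp only [mul_pow _ _ 2, ← Finset.mul_sum]
          have := hb.1 u
          rw [mul_pow] at this
          gcongr
  rcases eq_or_lt_of_le (norm_nonneg w) with h0 | hpos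
  · rw [← h0]; positivity
  · refine le_of_mul_le_mul_right (h1.trans (le_of_eq ?_)) hpos
    ring

theorem norm_pairing_sum_mul_mul_le {κ : Type*} [Fintype κ] {a b : κ → H →L[ℂ] H} {A B : ℝ}
    (hA : 0 ≤ A) (hB : 0 ≤ B) (ha : IsSquareBounded a A) (hb : IsSquareBounded b B)
    {n : ℕ} {u v : Fin n → H} (hu : IsBessel u) (hv : IsBessel v)
    {Y : H →L[ℂ] H} {d : ℕ} {x y : Fin d → H} (h : ∀ z, Y z = ∑ l, ⟪y l, z⟫_ℂ • x l) :
    ‖pairing u v (∑ k, a k * Y * b k)‖ ≤ ∑ l, (A * ‖x l‖) * (B * ‖y l‖) := by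
  have e : pairing u v (∑ k, a k * Y * b k) =
      ∑ l, ∑ k, ∑ j, ⟪v j, a k (x l)⟫_ℂ * ⟪ContinuousLinearMap.adjoint (b k) (y l), u j⟫_ℂ := by
    simp only [pairing_apply, inner_sum, mul_apply_eq_comp, h,
      map_sum, map_smul, inner_smul_right, ContinuousLinearMap.adjoint_inner_left]
    conv_rhs => rw [Finset.sum_comm]
    refine Finset.sum_congr rfl fun k _ => ?_
    rw [Finset.sum_comm]
    exact Finset.sum_congr rfl fun l _ => Finset.sum_congr rfl fun j _ => mul_comm _ _
  rw [e]
  refine norm_sum_le_of_le _ fun l _ => ?_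
  have h1 : ∀ k, ‖∑ j, ⟪v j, a k (x l)⟫_ℂ * ⟪ContinuousLinearMap.adjoint (b k) (y l), u j⟫_ℂ‖ ≤
      ‖a k (x l)‖ * ‖ContinuousLinearMap.adjoint (b k) (y l)‖ := fun k => by
    refine (norm_sum_le _ _).trans ?_
    simp only [norm_mul]
    refine sum_mul_le_of_sum_sq_le (norm_nonneg _) (norm_nonneg _) (hv _) ?_
    simpa only [norm_inner_symm] using hu (ContinuousLinearMap.adjoint (b k) (y l))
  exact (norm_sum_le_of_le _ fun k _ => h1 k).trans
    (sum_mul_le_of_sum_sq_le (by positivity) (by positivity) (ha.1 _) (hb.2 _))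

theorem sum_norm_cfc_sq_le {κ : Type*} [Fintype κ] {N : H →L[ℂ] H} (_hN : IsStarNormal N)
    {g : κ → ℂ → ℂ} (hg : ∀ k, ContinuousOn (g k) (spectrum ℂ N)) {D : ℝ}
    (hD : ∀ z ∈ spectrum ℂ N, ∑ k, ‖g k z‖ ^ 2 ≤ D ^ 2) (x : H) :
    ∑ k, ‖cfc (g k) N x‖ ^ 2 ≤ (D * ‖x‖) ^ 2 := by
  have h1 : ∑ k, star (cfc (g k) N) * cfc (g k) N = cfc (fun z => ∑ k, star (g k z) * g k z) N := by
    have h0 : (fun z => ∑ k, star (g k z) * g k z) = ∑ k, fun z => star (g k z) * g k z := by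
      ext; simp
    rw [h0, cfc_sum_univ (fun k z => star (g k z) * g k z) N fun k => (hg k).star.mul (hg k)]
    refine Finset.sum_congr rfl fun k _ => ?_
    rw [cfc_mul _ _ N (hg k).star (hg k), cfc_star]
  have h2 : ∀ k, ((‖cfc (g k) N x‖ ^ 2 : ℝ) : ℂ) = ⟪x, (star (cfc (g k) N) * cfc (g k) N) x⟫_ℂ := by
    intro k
    rw [mul_apply_eq_comp, ContinuousLinearMap.star_eq_adjoint,
      ContinuousLinearMap.adjoint_inner_right, inner_self_eq_norm_sq_to_K]
    simp
  have h3 : ((∑ k, ‖cfc (g k) N x‖ ^ 2 : ℝ) : ℂ) =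
      ⟪x, cfc (fun z => ∑ k, star (g k z) * g k z) N x⟫_ℂ := by
    rw [← h1, sum_apply, inner_sum, Complex.ofReal_sum]
    exact Finset.sum_congr rfl fun k _ => h2 k
  have h4 : ‖cfc (fun z => ∑ k, star (g k z) * g k z) N‖ ≤ D ^ 2 := by
    refine norm_cfc_le (by positivity) fun z hz => (norm_sum_le _ _).trans ?_
    refine le_trans (le_of_eq (Finset.sum_congr rfl fun k _ => ?_)) (hD z hz)
    rw [norm_mul, norm_star, sq]
  have h5 : ∑ k, ‖cfc (g k) N x‖ ^ 2 = ‖((∑ k, ‖cfc (g k) N x‖ ^ 2 : ℝ) : ℂ)‖ := by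
    rw [Complex.norm_of_nonneg (by positivity)]
  rw [h5, h3]
  calc _ ≤ ‖x‖ * ‖cfc (fun z => ∑ k, star (g k z) * g k z) N x‖ := norm_inner_le_norm _ _
    _ ≤ ‖x‖ * (D ^ 2 * ‖x‖) := by
        gcongr
        exact (ContinuousLinearMap.le_opNorm _ _).trans (by gcongr)
    _ = _ := by ring

theorem isSquareBounded_cfc {κ : Type*} [Fintype κ] {N : H →L[ℂ] H} (hN : IsStarNormal N)
    {g : κ → ℂ → ℂ} (hg : ∀ k, ContinuousOn (g k) (spectrum ℂ N)) {D : ℝ}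
    (hD : ∀ z ∈ spectrum ℂ N, ∑ k, ‖g k z‖ ^ 2 ≤ D ^ 2) :
    IsSquareBounded (fun k => cfc (g k) N) D := by
  refine ⟨sum_norm_cfc_sq_le hN hg hD, fun x => ?_⟩
  have := sum_norm_cfc_sq_le hN (g := fun k z => star (g k z)) (fun k => (hg k).star)
    (D := D) (by simpa using hD) x
  simpa only [cfc_star, ContinuousLinearMap.star_eq_adjoint] using this

theorem isSquareBounded_sum_smul_cfc {ι : Type*} [Fintype ι] {d : ℕ} {N : H →L[ℂ] H}
    (hN : IsStarNormal N) {c : ι → EuclideanSpace ℂ (Fin d)} {r : ι → ℂ → ℂ} {A ρ : ℝ} (hA : 0 ≤ A)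
    (hc : ∀ i, ‖c i‖ ≤ A) (hr : ∀ i, Continuous (r i))
    (hρ : ∀ z ∈ spectrum ℂ N, ∑ i, ‖r i z‖ ≤ ρ) :
    IsSquareBounded (fun k => ∑ i, c i k • cfc (r i) N) (ρ * A) := by
  have h : ∀ k, ∑ i, c i k • cfc (r i) N = cfc (fun z => ∑ i, c i k • r i z) N := fun k => by
    have h0 : (fun z => ∑ i, c i k • r i z) = ∑ i, fun z => c i k • r i z := by
      ext; simp
    rw [h0, cfc_sum_univ (fun i z => c i k • r i z) N
      fun i => ((hr i).const_smul (c i k)).continuousOn]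
    exact Finset.sum_congr rfl fun i _ => (cfc_smul _ _ N (hr i).continuousOn).symm
  simp only [h]
  refine isSquareBounded_cfc hN (g := fun k z => ∑ i, c i k • r i z)
    (fun k => (continuous_finsetSum _ fun i _ => (hr i).const_smul (c i k)).continuousOn)
    fun z hz => ?_
  have h1 : ‖∑ i, r i z • c i‖ ≤ ρ * A := by
    calc ‖∑ i, r i z • c i‖ ≤ ∑ i, ‖r i z‖ * A :=
          norm_sum_le_of_le _ fun i _ => by rw [norm_smul]; gcongr; exact hc i
      _ = (∑ i, ‖r i z‖) * A := by rw [Finset.sum_mul]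
      _ ≤ ρ * A := by gcongr; exact hρ z hz
  have h2 : ∑ k, ‖∑ i, c i k • r i z‖ ^ 2 = ‖∑ i, r i z • c i‖ ^ 2 := by
    rw [EuclideanSpace.norm_sq_eq]
    refine Finset.sum_congr rfl fun k _ => ?_
    congr 2
    simp [mul_comm]
  rw [h2]
  gcongr

theorem exists_euclidean_of_finite {ι κ E : Type*} [Finite ι] [Finite κ]
    [NormedAddCommGroup E] [InnerProductSpace ℂ E] (α : ι → E) (β : κ → E) :
    ∃ (d : ℕ) (a : ι → EuclideanSpace ℂ (Fin d)) (b : κ → EuclideanSpace ℂ (Fin d)),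
      (∀ i, ‖a i‖ = ‖α i‖) ∧ (∀ j, ‖b j‖ = ‖β j‖) ∧
      ∀ i j, ⟪α i, β j⟫_ℂ = ∑ k, a i k * b j k := by
  let S := Submodule.span ℂ (Set.range α ∪ Set.range β)
  have : FiniteDimensional ℂ S :=
    FiniteDimensional.span_of_finite ℂ ((Set.finite_range α).union (Set.finite_range β))
  let e := (stdOrthonormalBasis ℂ S).repr
  have hα : ∀ i, α i ∈ S := fun i => Submodule.subset_span (Or.inl ⟨i, rfl⟩)
  have hβ : ∀ j, β j ∈ S := fun j => Submodule.subset_span (Or.inr ⟨j, rfl⟩)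
  refine ⟨_, fun i => WithLp.toLp 2 fun k => star (e ⟨α i, hα i⟩ k), fun j => e ⟨β j, hβ j⟩,
    fun i => ?_, fun j => ?_, fun i j => ?_⟩
  · have h1 : ‖e ⟨α i, hα i⟩‖ = ‖α i‖ := by
      rw [LinearIsometryEquiv.norm_map]; rfl
    rw [← h1, EuclideanSpace.norm_eq, EuclideanSpace.norm_eq]
    simp
  · rw [LinearIsometryEquiv.norm_map]; rfl
  · have h1 : ⟪α i, β j⟫_ℂ = ⟪e ⟨α i, hα i⟩, e ⟨β j, hβ j⟩⟫_ℂ := by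
      rw [LinearIsometryEquiv.inner_map_map]; rfl
    rw [h1, PiLp.inner_apply]
    exact Finset.sum_congr rfl fun k _ => by simp [mul_comm]

theorem exists_schurMap_eq_sum {ι κ E : Type*} [Fintype ι] [Fintype κ]
    [NormedAddCommGroup E] [InnerProductSpace ℂ E] {N₁ N₂ : H →L[ℂ] H}
    (hN₁ : IsStarNormal N₁) (hN₂ : IsStarNormal N₂) {α : ι → E} {β : κ → E} {A B ρ τ : ℝ}
    (hA : 0 ≤ A) (hB : 0 ≤ B) (hα : ∀ i, ‖α i‖ ≤ A) (hβ : ∀ j, ‖β j‖ ≤ B)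
    {r : ι → ℂ → ℂ} {q : κ → ℂ → ℂ} (hr : ∀ i, Continuous (r i)) (hq : ∀ j, Continuous (q j))
    (hρ : ∀ z ∈ spectrum ℂ N₁, ∑ i, ‖r i z‖ ≤ ρ) (hτ : ∀ z ∈ spectrum ℂ N₂, ∑ j, ‖q j z‖ ≤ τ) :
    ∃ (d : ℕ) (a b : Fin d → H →L[ℂ] H), IsSquareBounded a (ρ * A) ∧ IsSquareBounded b (τ * B) ∧
      ∀ Y, schurMap (fun i j => ⟪α i, β j⟫_ℂ) (fun i => cfc (r i) N₁) (fun j => cfc (q j) N₂) Y =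
        ∑ k, a k * Y * b k := by
  obtain ⟨d, a, b, ha, hb, hab⟩ := exists_euclidean_of_finite α β
  refine ⟨d, _, _, isSquareBounded_sum_smul_cfc hN₁ hA (fun i => (ha i).trans_le (hα i)) hr hρ,
    isSquareBounded_sum_smul_cfc hN₂ hB (fun j => (hb j).trans_le (hβ j)) hq hτ, fun Y => ?_⟩
  simp only [schurMap_apply, hab, Finset.sum_smul, Finset.sum_mul, Finset.mul_sum, smul_mul_assoc,
    mul_smul_comm, Finset.smul_sum]
  symm
  refine Finset.sum_comm.trans (((Finset.sum_congr rfl fun j _ => Finset.sum_comm).trans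
    Finset.sum_comm).trans ?_)
  exact Finset.sum_congr rfl fun i _ => Finset.sum_congr rfl fun j _ =>
    Finset.sum_congr rfl fun k _ => by rw [smul_smul, mul_comm]

end SchurMaps

section Discretisation

open scoped InnerProductSpace

theorem exists_partition_of_unity {K : Set ℂ} (hK : IsCompact K) {δ : ℝ} (hδ : 0 < δ) :
    ∃ (m : ℕ) (z : Fin m → ℂ) (p : Fin m → ℂ → ℝ), (∀ i, z i ∈ K) ∧ (∀ i, Continuous (p i)) ∧
      (∀ i x, 0 ≤ p i x) ∧ (∀ x ∈ K, ∑ i, p i x = 1) ∧ ∀ i x, p i x ≠ 0 → dist x (z i) < δ := by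
  obtain ⟨t, htK, hfin, hcov⟩ := hK.finite_cover_balls hδ
  obtain ⟨m, z, -, rfl⟩ := hfin.fin_param
  obtain ⟨p, hsub, hone, hp01, -⟩ := exists_continuous_sum_one_of_isOpen_isCompact
    (s := fun i => Metric.ball (z i) δ) (fun _ => Metric.isOpen_ball) hK
    (by simpa using hcov)
  refine ⟨m, z, fun i => p i, fun i => htK ⟨i, rfl⟩, fun i => (p i).continuous,
    fun i x => (hp01 i x).1, fun x hx => by simpa using hone hx, fun i x hx => ?_⟩
  exact hsub i (subset_tsupport _ hx)

variable {H : Type*} [NormedAddCommGroup H] [InnerProductSpace ℂ H]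

/-- A finite partition of unity on the spectrum of `N`, subordinate to `δ`-balls. -/
structure SpectralPartition (N : H →L[ℂ] H) (δ : ℝ) {m : ℕ} (z : Fin m → ℂ)
    (p : Fin m → ℂ → ℝ) : Prop where
  mem : ∀ i, z i ∈ spectrum ℂ N
  cont : ∀ i, Continuous (p i)
  nonneg : ∀ i x, 0 ≤ p i x
  sum_eq_one : ∀ x ∈ spectrum ℂ N, ∑ i, p i x = 1
  dist_lt : ∀ i x, p i x ≠ 0 → dist x (z i) < δ

namespace SpectralPartition

variable {N : H →L[ℂ] H} {δ : ℝ} {m : ℕ} {z : Fin m → ℂ} {p : Fin m → ℂ → ℝ}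

theorem continuous_ofReal (h : SpectralPartition N δ z p) (i : Fin m) :
    Continuous fun x => (p i x : ℂ) :=
  Complex.continuous_ofReal.comp (h.cont i)

theorem sum_norm_le_one (h : SpectralPartition N δ z p) :
    ∀ x ∈ spectrum ℂ N, ∑ i, ‖(p i x : ℂ)‖ ≤ 1 := fun x hx => by
  rw [← h.sum_eq_one x hx]
  exact le_of_eq (Finset.sum_congr rfl fun i _ => Complex.norm_of_nonneg (h.nonneg i x))

theorem sum_norm_mul_sub_le (h : SpectralPartition N δ z p) {g : ℂ → ℂ} {ε : ℝ}
    (hg : ∀ i, ∀ x ∈ spectrum ℂ N, dist x (z i) < δ → ‖g (z i) - g x‖ ≤ ε) :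
    ∀ x ∈ spectrum ℂ N, ∑ i, ‖(g (z i) - g x) * (p i x : ℂ)‖ ≤ ε := fun x hx => by
  calc ∑ i, ‖(g (z i) - g x) * (p i x : ℂ)‖ ≤ ∑ i, ε * p i x := by
        refine Finset.sum_le_sum fun i _ => ?_
        rw [norm_mul, Complex.norm_of_nonneg (h.nonneg i x)]
        by_cases h0 : p i x = 0
        · simp [h0]
        · exact mul_le_mul_of_nonneg_right (hg i x hx (h.dist_lt i x h0)) (h.nonneg i x)
    _ = ε := by rw [← Finset.mul_sum, h.sum_eq_one x hx, mul_one]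

variable [CompleteSpace H]

theorem sum_cfc_eq_one (h : SpectralPartition N δ z p) (hN : IsStarNormal N) :
    ∑ i, cfc (fun x => (p i x : ℂ)) N = 1 := by
  rw [← cfc_sum_univ (fun i x => (p i x : ℂ)) N fun i => (h.continuous_ofReal i).continuousOn,
    ← cfc_one (R := ℂ) (a := N)]
  refine cfc_congr fun x hx => ?_
  simp only [Finset.sum_apply, Pi.one_apply]
  exact_mod_cast congrArg (fun r : ℝ => (r : ℂ)) (h.sum_eq_one x hx)

theorem cfc_sub_mul (h : SpectralPartition N δ z p) (_hN : IsStarNormal N) {g : ℂ → ℂ}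
    (hg : Continuous g) (i : Fin m) :
    cfc (fun x => (g (z i) - g x) * (p i x : ℂ)) N =
      g (z i) • cfc (fun x => (p i x : ℂ)) N - cfc (fun x => (p i x : ℂ)) N * cfc g N ∧
    cfc (fun x => (g (z i) - g x) * (p i x : ℂ)) N =
      g (z i) • cfc (fun x => (p i x : ℂ)) N - cfc g N * cfc (fun x => (p i x : ℂ)) N := by
  have hp := (h.continuous_ofReal i).continuousOn (s := spectrum ℂ N)
  have hgc := hg.continuousOn (s := spectrum ℂ N)
  have h1 : cfc (fun x => (g (z i) - g x) * (p i x : ℂ)) N =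
      g (z i) • cfc (fun x => (p i x : ℂ)) N - cfc g N * cfc (fun x => (p i x : ℂ)) N := by
    simp only [sub_mul]
    rw [cfc_sub (fun x => g (z i) * (p i x : ℂ)) (fun x => g x * (p i x : ℂ)) N
        (continuousOn_const.mul hp) (hgc.mul hp),
      cfc_const_mul (g (z i)) (fun x => (p i x : ℂ)) N hp,
      cfc_mul g (fun x => (p i x : ℂ)) N hgc hp]
  exact ⟨by rw [h1, (cfc_commute_cfc g (fun x => (p i x : ℂ)) N).eq], h1⟩

theorem norm_cfc_sub_sum_le (h : SpectralPartition N δ z p) (hN : IsStarNormal N) {g : ℂ → ℂ}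
    (hgc : Continuous g) {ε : ℝ} (hε : 0 ≤ ε)
    (hg : ∀ i, ∀ x ∈ spectrum ℂ N, dist x (z i) < δ → ‖g (z i) - g x‖ ≤ ε) :
    ‖cfc g N - ∑ i, g (z i) • cfc (fun x => (p i x : ℂ)) N‖ ≤ ε := by
  have e : cfc g N - ∑ i, g (z i) • cfc (fun x => (p i x : ℂ)) N =
      -cfc (∑ i, fun x => (g (z i) - g x) * (p i x : ℂ)) N := by
    rw [cfc_sum_univ (fun i x => (g (z i) - g x) * (p i x : ℂ)) N fun i =>
      ((continuous_const.sub hgc).mul (h.continuous_ofReal i)).continuousOn]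
    simp only [fun i => (h.cfc_sub_mul hN hgc i).2, Finset.sum_sub_distrib, ← Finset.mul_sum,
      h.sum_cfc_eq_one hN, mul_one]
    abel
  rw [e, norm_neg]
  refine norm_cfc_le hε fun x hx => ?_
  rw [Finset.sum_apply]
  exact (norm_sum_le _ _).trans (h.sum_norm_mul_sub_le hg x hx)

end SpectralPartition

variable [CompleteSpace H]

theorem exists_spectralPartition (N : H →L[ℂ] H) {δ : ℝ} (hδ : 0 < δ) :
    ∃ (m : ℕ) (z : Fin m → ℂ) (p : Fin m → ℂ → ℝ), SpectralPartition N δ z p := by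
  obtain ⟨m, z, p, h1, h2, h3, h4, h5⟩ := exists_partition_of_unity (spectrum.isCompact N) hδ
  exact ⟨m, z, p, h1, h2, h3, h4, h5⟩

variable {E : Type*} [NormedAddCommGroup E] [InnerProductSpace ℂ E]

theorem norm_schurMap_le {N₁ N₂ : H →L[ℂ] H} (hN₁ : IsStarNormal N₁) (hN₂ : IsStarNormal N₂)
    {ι κ : Type*} [Fintype ι] [Fintype κ] {α : ι → E} {β : κ → E} {A B ρ τ : ℝ}
    (hA : 0 ≤ A) (hB : 0 ≤ B) (hρ0 : 0 ≤ ρ) (hτ0 : 0 ≤ τ)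
    (hα : ∀ i, ‖α i‖ ≤ A) (hβ : ∀ j, ‖β j‖ ≤ B)
    {r : ι → ℂ → ℂ} {q : κ → ℂ → ℂ} (hr : ∀ i, Continuous (r i)) (hq : ∀ j, Continuous (q j))
    (hρ : ∀ z ∈ spectrum ℂ N₁, ∑ i, ‖r i z‖ ≤ ρ) (hτ : ∀ z ∈ spectrum ℂ N₂, ∑ j, ‖q j z‖ ≤ τ)
    (Y : H →L[ℂ] H) :
    ‖schurMap (fun i j => ⟪α i, β j⟫_ℂ) (fun i => cfc (r i) N₁) (fun j => cfc (q j) N₂) Y‖ ≤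
      ρ * A * (τ * B) * ‖Y‖ := by
  obtain ⟨d, a, b, ha, hb, h⟩ := exists_schurMap_eq_sum hN₁ hN₂ hA hB hα hβ hr hq hρ hτ
  rw [h]
  exact norm_sum_mul_mul_le (by positivity) (by positivity) ha hb Y

theorem norm_pairing_schurMap_le {N₁ N₂ : H →L[ℂ] H} (hN₁ : IsStarNormal N₁)
    (hN₂ : IsStarNormal N₂)
    {ι κ : Type*} [Fintype ι] [Fintype κ] {α : ι → E} {β : κ → E} {A B : ℝ}
    (hA : 0 ≤ A) (hB : 0 ≤ B) (hα : ∀ i, ‖α i‖ ≤ A) (hβ : ∀ j, ‖β j‖ ≤ B)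
    {r : ι → ℂ → ℂ} {q : κ → ℂ → ℂ} (hr : ∀ i, Continuous (r i)) (hq : ∀ j, Continuous (q j))
    (hρ : ∀ z ∈ spectrum ℂ N₁, ∑ i, ‖r i z‖ ≤ 1) (hτ : ∀ z ∈ spectrum ℂ N₂, ∑ j, ‖q j z‖ ≤ 1)
    {n : ℕ} {u v : Fin n → H} (hu : IsBessel u) (hv : IsBessel v)
    {k : ℕ} {Y : H →L[ℂ] H} (hY : LinearMap.rank (Y : H →ₗ[ℂ] H) ≤ k) :
    ‖pairing u v (schurMap (fun i j => ⟪α i, β j⟫_ℂ) (fun i => cfc (r i) N₁)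
      (fun j => cfc (q j) N₂) Y)‖ ≤ A * B * (k * ‖Y‖) ∧
    ‖pairing u v (schurMap (fun i j => ⟪α i, β j⟫_ℂ) (fun i => cfc (r i) N₁)
      (fun j => cfc (q j) N₂) (star Y))‖ ≤ A * B * (k * ‖Y‖) := by
  obtain ⟨d, a, b, ha, hb, h⟩ := exists_schurMap_eq_sum hN₁ hN₂ hA hB hα hβ hr hq hρ hτ
  rw [one_mul] at ha hb
  obtain ⟨D, x, y, hD, hx, hy, hxy⟩ := exists_sum_rankOne hY
  have hbound : ∑ _l : Fin D, A * B * ‖Y‖ ≤ A * B * (k * ‖Y‖) := by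
    have : (D : ℝ) ≤ k := by exact_mod_cast hD
    rw [Finset.sum_const, Finset.card_univ, Fintype.card_fin, nsmul_eq_mul]
    calc (D : ℝ) * (A * B * ‖Y‖) ≤ k * (A * B * ‖Y‖) := by gcongr
      _ = _ := by ring
  have hl : ∀ l, (A * ‖x l‖) * (B * ‖y l‖) ≤ A * B * ‖Y‖ := fun l =>
    calc (A * ‖x l‖) * (B * ‖y l‖) ≤ (A * 1) * (B * ‖Y‖) := by
          gcongr
          · exact hx l
          · exact hy l
      _ = _ := by ring
  rw [h, h]
  constructor
  · exact (norm_pairing_sum_mul_mul_le hA hB ha hb hu hv hxy).trans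
      ((Finset.sum_le_sum fun l _ => hl l).trans hbound)
  · refine (norm_pairing_sum_mul_mul_le hA hB ha hb hu hv
      (adjoint_apply_of_sum_rankOne hxy)).trans
      ((Finset.sum_le_sum fun l _ => ?_).trans hbound)
    exact (le_of_eq (by ring)).trans (hl l)

/-- Replacing `(g (z i) - g (w j)) • P i * Q j` by `P i * (g(N₁) - g(N₂)) * Q j` costs little. -/
theorem norm_schurMap_one_sub_le {N₁ N₂ : H →L[ℂ] H} (hN₁ : IsStarNormal N₁)
    (hN₂ : IsStarNormal N₂) {δ A B : ℝ} (hδ : 0 ≤ δ) (hA : 0 ≤ A) (hB : 0 ≤ B) {m₁ m₂ : ℕ}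
    {z : Fin m₁ → ℂ} {p : Fin m₁ → ℂ → ℝ} (hp : SpectralPartition N₁ δ z p)
    {w : Fin m₂ → ℂ} {q : Fin m₂ → ℂ → ℝ} (hq : SpectralPartition N₂ δ w q)
    {α : Fin m₁ → E} {β : Fin m₂ → E} (hα : ∀ i, ‖α i‖ ≤ A) (hβ : ∀ j, ‖β j‖ ≤ B)
    {g : ℂ → ℂ} (hg : Continuous g) (hlip : ∀ x y, ‖g x - g y‖ ≤ dist x y) :
    ‖schurMap (fun i j => (g (z i) - g (w j)) * ⟪α i, β j⟫_ℂ) (fun i => cfc (fun x => (p i x : ℂ)) N₁)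
        (fun j => cfc (fun x => (q j x : ℂ)) N₂) 1 -
      schurMap (fun i j => ⟪α i, β j⟫_ℂ) (fun i => cfc (fun x => (p i x : ℂ)) N₁)
        (fun j => cfc (fun x => (q j x : ℂ)) N₂) (cfc g N₁ - cfc g N₂)‖ ≤ 2 * δ * (A * B) := by
  have hone : ‖(1 : H →L[ℂ] H)‖ ≤ 1 := ContinuousLinearMap.norm_id_le
  have hclose : ∀ x y, dist x y < δ → ‖g y - g x‖ ≤ δ := fun x y h =>
    (hlip y x).trans (by rw [dist_comm]; exact h.le)
  have e1 := norm_schurMap_le hN₁ hN₂ hA hB hδ zero_le_one hα hβ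
    (r := fun i x => (g (z i) - g x) * (p i x : ℂ)) (q := fun j x => (q j x : ℂ))
    (fun i => (continuous_const.sub hg).mul (hp.continuous_ofReal i))
    hq.continuous_ofReal (hp.sum_norm_mul_sub_le fun i x _ h => hclose _ _ h)
    hq.sum_norm_le_one 1
  have e2 := norm_schurMap_le hN₁ hN₂ hA hB zero_le_one hδ hα hβ
    (r := fun i x => (p i x : ℂ)) (q := fun j x => (g (w j) - g x) * (q j x : ℂ))
    hp.continuous_ofReal (fun j => (continuous_const.sub hg).mul (hq.continuous_ofReal j))
    hp.sum_norm_le_one (hq.sum_norm_mul_sub_le fun i x _ h => hclose _ _ h) 1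
  have e : ∀ S T : H →L[ℂ] H, ‖S‖ ≤ δ * A * (1 * B) * ‖(1 : H →L[ℂ] H)‖ →
      ‖T‖ ≤ 1 * A * (δ * B) * ‖(1 : H →L[ℂ] H)‖ → ‖S - T‖ ≤ 2 * δ * (A * B) := by
    intro S T hS hT
    have h1 : δ * A * (1 * B) * ‖(1 : H →L[ℂ] H)‖ ≤ δ * A * (1 * B) * 1 := by gcongr
    have h2 : 1 * A * (δ * B) * ‖(1 : H →L[ℂ] H)‖ ≤ 1 * A * (δ * B) * 1 := by gcongr
    linarith [norm_sub_le S T]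
  refine le_trans (le_of_eq (congrArg norm ?_)) (e _ _ e1 e2)
  simp only [schurMap_apply, ← Finset.sum_sub_distrib]
  refine Finset.sum_congr rfl fun i _ => Finset.sum_congr rfl fun j _ => ?_
  rw [(hp.cfc_sub_mul hN₁ hg i).1, (hq.cfc_sub_mul hN₂ hg j).2, mul_comm, mul_smul, ← smul_sub,
    ← smul_sub]
  simp only [mul_one, mul_sub, sub_mul, smul_mul_assoc, mul_smul_comm, sub_smul, mul_assoc]
  congr 1
  abel

theorem cfc_re_eq {N : H →L[ℂ] H} (hN : IsStarNormal N) :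
    cfc (fun x : ℂ => (x.re : ℂ)) N = (1 / 2 : ℂ) • (N + star N) := by
  have : (fun x : ℂ => (x.re : ℂ)) = fun x => (1 / 2 : ℂ) • (x + star x) := by
    ext x
    rw [Complex.re_eq_add_conj, smul_eq_mul, Complex.star_def]
    ring
  rw [this, cfc_smul .., cfc_add .., cfc_id' .., cfc_star_id ..]

theorem cfc_im_eq {N : H →L[ℂ] H} (hN : IsStarNormal N) :
    cfc (fun x : ℂ => (x.im : ℂ)) N = (1 / (2 * Complex.I) : ℂ) • (N - star N) := by
  have : (fun x : ℂ => (x.im : ℂ)) = fun x => (1 / (2 * Complex.I) : ℂ) • (x - star x) := by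
    ext x
    rw [Complex.im_eq_sub_conj, smul_eq_mul, Complex.star_def]
    ring
  rw [this, cfc_smul .., cfc_sub .., cfc_id' .., cfc_star_id ..]

theorem norm_pairing_cfc_sub_le {N₁ N₂ : H →L[ℂ] H} (hN₁ : IsStarNormal N₁)
    (hN₂ : IsStarNormal N₂) {f : ℂ → ℂ} (hf : Continuous f) {α₁ β₁ α₂ β₂ : ℂ → E} {M : ℝ}
    {A B : ℝ} (hA : 0 ≤ A) (hB : 0 ≤ B) (hM : A * B ≤ M)
    (hα₁ : ∀ z, ‖α₁ z‖ ≤ A) (hβ₁ : ∀ z, ‖β₁ z‖ ≤ B) (hα₂ : ∀ z, ‖α₂ z‖ ≤ A) (hβ₂ : ∀ z, ‖β₂ z‖ ≤ B)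
    (h : ∀ z w : ℂ, f z - f w = ((z.re : ℂ) - w.re) * ⟪α₁ z, β₁ w⟫_ℂ +
      ((z.im : ℂ) - w.im) * ⟪α₂ z, β₂ w⟫_ℂ)
    {n : ℕ} {u v : Fin n → H} (hu : IsBessel u) (hv : IsBessel v) :
    ‖pairing u v (cfc f N₁ - cfc f N₂)‖ ≤ 26 * M * ∑ j ∈ Finset.range n, sNum (N₁ - N₂) j := by
  have hM0 : 0 ≤ M := (by positivity : 0 ≤ A * B).trans hM
  have main : ∀ ε : ℝ, 0 < ε → ‖pairing u v (cfc f N₁ - cfc f N₂)‖ ≤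
      26 * M * ∑ j ∈ Finset.range n, sNum (N₁ - N₂) j + n * (2 * ε + 4 * ε * M) := by
    intro ε hε
    have huc : ∀ N : H →L[ℂ] H, ∃ δ > 0, ∀ x ∈ spectrum ℂ N, ∀ y ∈ spectrum ℂ N,
        dist x y < δ → dist (f x) (f y) < ε := fun N =>
      Metric.uniformContinuousOn_iff.1
        ((spectrum.isCompact N).uniformContinuousOn_of_continuous hf.continuousOn) ε hε
    obtain ⟨δ₁, hδ₁, hf₁⟩ := huc N₁
    obtain ⟨δ₂, hδ₂, hf₂⟩ := huc N₂
    set δ := min ε (min δ₁ δ₂) with hδdef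
    have hδ : 0 < δ := by positivity
    have hδε : δ ≤ ε := min_le_left _ _
    have hδ₁' : δ ≤ δ₁ := (min_le_right _ _).trans (min_le_left _ _)
    have hδ₂' : δ ≤ δ₂ := (min_le_right _ _).trans (min_le_right _ _)
    obtain ⟨m₁, z, p, hp⟩ := exists_spectralPartition N₁ hδ
    obtain ⟨m₂, w, q, hq⟩ := exists_spectralPartition N₂ hδ
    set P := fun i => cfc (fun x => (p i x : ℂ)) N₁ with hP
    set Q := fun j => cfc (fun x => (q j x : ℂ)) N₂ with hQ
    have b1 : ‖cfc f N₁ - ∑ i, f (z i) • P i‖ ≤ ε :=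
      hp.norm_cfc_sub_sum_le hN₁ hf hε.le fun i x hx hd => by
        rw [← dist_eq_norm, dist_comm]
        exact (hf₁ x hx _ (hp.mem i) (hd.trans_le hδ₁')).le
    have b2 : ‖cfc f N₂ - ∑ j, f (w j) • Q j‖ ≤ ε :=
      hq.norm_cfc_sub_sum_le hN₂ hf hε.le fun i x hx hd => by
        rw [← dist_eq_norm, dist_comm]
        exact (hf₂ x hx _ (hq.mem i) (hd.trans_le hδ₂')).le
    set m₁' := fun (i : Fin m₁) (j : Fin m₂) => ⟪α₁ (z i), β₁ (w j)⟫_ℂ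
    set m₂' := fun (i : Fin m₁) (j : Fin m₂) => ⟪α₂ (z i), β₂ (w j)⟫_ℂ
    have b3 := norm_schurMap_one_sub_le hN₁ hN₂ hδ.le hA hB hp hq
      (α := fun i => α₁ (z i)) (β := fun j => β₁ (w j)) (fun _ => hα₁ _) (fun _ => hβ₁ _)
      (g := fun x => (x.re : ℂ)) (by fun_prop) (fun x y => by
        rw [← Complex.ofReal_sub, Complex.norm_real, ← Complex.sub_re, dist_eq_norm]
        exact Complex.abs_re_le_norm _)
    have b4 := norm_schurMap_one_sub_le hN₁ hN₂ hδ.le hA hB hp hq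
      (α := fun i => α₂ (z i)) (β := fun j => β₂ (w j)) (fun _ => hα₂ _) (fun _ => hβ₂ _)
      (g := fun x => (x.im : ℂ)) (by fun_prop) (fun x y => by
        rw [← Complex.ofReal_sub, Complex.norm_real, ← Complex.sub_im, dist_eq_norm]
        exact Complex.abs_im_le_norm _)
    set S₁ := schurMap (fun i j => (((z i).re : ℂ) - (w j).re) * m₁' i j) P Q 1 with hS₁
    set S₂ := schurMap (fun i j => (((z i).im : ℂ) - (w j).im) * m₂' i j) P Q 1 with hS₂
    have e1 : ∑ i, f (z i) • P i - ∑ j, f (w j) • Q j = S₁ + S₂ := by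
      have hP1 : ∑ i, P i = 1 := hp.sum_cfc_eq_one hN₁
      have hQ1 : ∑ j, Q j = 1 := hq.sum_cfc_eq_one hN₂
      have l1 : ∑ i, f (z i) • P i = ∑ i, ∑ j, f (z i) • (P i * Q j) := by
        refine Finset.sum_congr rfl fun i _ => ?_
        rw [← Finset.smul_sum, ← Finset.mul_sum, hQ1, mul_one]
      have l2 : ∑ j, f (w j) • Q j = ∑ i, ∑ j, f (w j) • (P i * Q j) := by
        rw [Finset.sum_comm]
        refine Finset.sum_congr rfl fun j _ => ?_
        rw [← Finset.smul_sum, ← Finset.sum_mul, hP1, one_mul]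
      rw [l1, l2, hS₁, hS₂, schurMap_apply, schurMap_apply, ← Finset.sum_sub_distrib,
        ← Finset.sum_add_distrib]
      refine Finset.sum_congr rfl fun i _ => ?_
      rw [← Finset.sum_sub_distrib, ← Finset.sum_add_distrib]
      refine Finset.sum_congr rfl fun j _ => ?_
      rw [← sub_smul, mul_one, ← add_smul, h]
    set Ψ : (H →L[ℂ] H) → (H →L[ℂ] H) := fun Y =>
      (1 / 2 : ℂ) • (schurMap m₁' P Q Y + schurMap m₁' P Q (star Y)) +
      (1 / (2 * Complex.I) : ℂ) • (schurMap m₂' P Q Y - schurMap m₂' P Q (star Y)) with hΨ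
    have e2 : schurMap m₁' P Q (cfc (fun x : ℂ => (x.re : ℂ)) N₁ - cfc (fun x : ℂ => (x.re : ℂ)) N₂) +
        schurMap m₂' P Q (cfc (fun x : ℂ => (x.im : ℂ)) N₁ - cfc (fun x : ℂ => (x.im : ℂ)) N₂) =
        Ψ (N₁ - N₂) := by
      simp only [cfc_re_eq hN₁, cfc_re_eq hN₂, cfc_im_eq hN₁, cfc_im_eq hN₂, ← smul_sub, map_smul, hΨ,
        star_sub, ← map_add, ← map_sub]
      congr 3 <;> abel_nf
    have hc1 : ‖(1 / 2 : ℂ)‖ = 1 / 2 := by simp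
    have hc2 : ‖(1 / (2 * Complex.I) : ℂ)‖ = 1 / 2 := by simp
    have comb : ∀ (Y : H →L[ℂ] H) (C : ℝ),
        ‖pairing u v (schurMap m₁' P Q Y)‖ ≤ C → ‖pairing u v (schurMap m₁' P Q (star Y))‖ ≤ C →
        ‖pairing u v (schurMap m₂' P Q Y)‖ ≤ C → ‖pairing u v (schurMap m₂' P Q (star Y))‖ ≤ C →
        ‖pairing u v (Ψ Y)‖ ≤ 2 * C := by
      intro Y C h1 h2 h3 h4
      simp only [hΨ, map_add, map_sub, map_smul]
      refine (norm_add_le _ _).trans ?_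
      rw [norm_smul, norm_smul, hc1, hc2]
      linarith [norm_add_le (pairing u v (schurMap m₁' P Q Y)) (pairing u v (schurMap m₁' P Q (star Y))),
        norm_sub_le (pairing u v (schurMap m₂' P Q Y)) (pairing u v (schurMap m₂' P Q (star Y)))]
    have hAB : 0 ≤ A * B := by positivity
    have bd : ∀ (α : Fin m₁ → E) (β : Fin m₂ → E), (∀ i, ‖α i‖ ≤ A) → (∀ j, ‖β j‖ ≤ B) →
        ∀ Y : H →L[ℂ] H,
        ‖pairing u v (schurMap (fun i j => ⟪α i, β j⟫_ℂ) P Q Y)‖ ≤ M * (n * ‖Y‖) := by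
      intro α β hα hβ Y
      refine (norm_pairing_le hu hv _).trans ?_
      have := norm_schurMap_le hN₁ hN₂ hA hB zero_le_one zero_le_one hα hβ
        hp.continuous_ofReal hq.continuous_ofReal hp.sum_norm_le_one hq.sum_norm_le_one Y
      simp only [one_mul] at this
      calc _ ≤ n * (A * B * ‖Y‖) := by gcongr
        _ ≤ n * (M * ‖Y‖) := by gcongr
        _ = _ := by ring
    have rk : ∀ (α : Fin m₁ → E) (β : Fin m₂ → E), (∀ i, ‖α i‖ ≤ A) → (∀ j, ‖β j‖ ≤ B) →
        ∀ (r : ℕ) (Y : H →L[ℂ] H), LinearMap.rank (Y : H →ₗ[ℂ] H) ≤ r →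
        ‖pairing u v (schurMap (fun i j => ⟪α i, β j⟫_ℂ) P Q Y)‖ ≤ M * (r * ‖Y‖) ∧
        ‖pairing u v (schurMap (fun i j => ⟪α i, β j⟫_ℂ) P Q (star Y))‖ ≤ M * (r * ‖Y‖) := by
      intro α β hα hβ r Y hY
      have := norm_pairing_schurMap_le hN₁ hN₂ hA hB hα hβ
        hp.continuous_ofReal hq.continuous_ofReal hp.sum_norm_le_one hq.sum_norm_le_one hu hv hY
      have h2 : A * B * (r * ‖Y‖) ≤ M * (r * ‖Y‖) := by gcongr
      exact ⟨this.1.trans h2, this.2.trans h2⟩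
    have key := le_sum_sNum_of_subadditive (ℓ := fun Y => ‖pairing u v (Ψ Y)‖) (M := 2 * M)
      (by positivity) (n := n)
      (fun Y Z => by
        have : Ψ (Y + Z) = Ψ Y + Ψ Z := by
          simp only [hΨ, star_add, map_add, smul_add, smul_sub]
          abel
        rw [this, map_add]
        exact norm_add_le _ _)
      (fun Y => by
        have hs : ‖star Y‖ = ‖Y‖ := norm_star Y
        rw [mul_assoc]
        refine comb Y _ (bd _ _ (fun _ => hα₁ _) (fun _ => hβ₁ _) Y) ?_
          (bd _ _ (fun _ => hα₂ _) (fun _ => hβ₂ _) Y) ?_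
        · rw [← hs]; exact bd _ _ (fun _ => hα₁ _) (fun _ => hβ₁ _) _
        · rw [← hs]; exact bd _ _ (fun _ => hα₂ _) (fun _ => hβ₂ _) _)
      (fun r Y hY => by
        have r1 := rk _ _ (fun i => hα₁ (z i)) (fun j => hβ₁ (w j)) r Y hY
        have r2 := rk _ _ (fun i => hα₂ (z i)) (fun j => hβ₂ (w j)) r Y hY
        rw [mul_assoc]
        exact comb Y _ r1.1 r1.2 r2.1 r2.2)
      (N₁ - N₂)
    have err : ‖(cfc f N₁ - cfc f N₂) - Ψ (N₁ - N₂)‖ ≤ 2 * ε + 4 * ε * M := by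
      rw [← e2]
      have e3 : ∀ F₁ F₂ G₁ G₂ T₁ T₂ : H →L[ℂ] H, G₁ - G₂ = S₁ + S₂ →
          (F₁ - F₂) - (T₁ + T₂) = (F₁ - G₁) - (F₂ - G₂) + ((S₁ - T₁) + (S₂ - T₂)) := by
        intro F₁ F₂ G₁ G₂ T₁ T₂ hG
        have : (F₁ - G₁) - (F₂ - G₂) + ((S₁ - T₁) + (S₂ - T₂)) =
          (F₁ - F₂) - (G₁ - G₂) + (S₁ + S₂) - (T₁ + T₂) := by abel
        rw [this, hG]
        abel
      rw [e3 _ _ _ _ _ _ e1]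
      refine (norm_add_le _ _).trans ?_
      have n1 := norm_sub_le (cfc f N₁ - ∑ i, f (z i) • P i) (cfc f N₂ - ∑ j, f (w j) • Q j)
      have n3 : 2 * δ * (A * B) ≤ 2 * ε * M := by gcongr
      have n2 := norm_add_le_of_le (b3.trans n3) (b4.trans n3)
      linarith
    have split : pairing u v (cfc f N₁ - cfc f N₂) =
        pairing u v ((cfc f N₁ - cfc f N₂) - Ψ (N₁ - N₂)) + pairing u v (Ψ (N₁ - N₂)) := by
      rw [← map_add, sub_add_cancel]
    rw [split]
    refine (norm_add_le _ _).trans ?_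
    have n4 := norm_pairing_le hu hv ((cfc f N₁ - cfc f N₂) - Ψ (N₁ - N₂))
    have n5 : (n : ℝ) * ‖(cfc f N₁ - cfc f N₂) - Ψ (N₁ - N₂)‖ ≤ n * (2 * ε + 4 * ε * M) := by gcongr
    linarith
  refine le_of_forall_pos_le_add fun η hη => ?_
  have hpos : 0 < n * (2 + 4 * M) + 1 := by positivity
  have h1 := main (η / (n * (2 + 4 * M) + 1)) (by positivity)
  have h2 : n * (2 + 4 * M) * (η / (n * (2 + 4 * M) + 1)) ≤ η := by
    rw [mul_div_assoc', div_le_iff₀ hpos]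
    nlinarith
  linarith

/-- Weak majorization of the singular values of `f(N₁) - f(N₂)` by those of `N₁ - N₂`, when the
divided differences of `f` factor through a Hilbert space. -/
theorem sum_sNum_cfc_sub_le {N₁ N₂ : H →L[ℂ] H} (hN₁ : IsStarNormal N₁)
    (hN₂ : IsStarNormal N₂) {f : ℂ → ℂ} (hf : Continuous f) {α₁ β₁ α₂ β₂ : ℂ → E} {M : ℝ}
    {A B : ℝ} (hA : 0 ≤ A) (hB : 0 ≤ B) (hM : A * B ≤ M)
    (hα₁ : ∀ z, ‖α₁ z‖ ≤ A) (hβ₁ : ∀ z, ‖β₁ z‖ ≤ B) (hα₂ : ∀ z, ‖α₂ z‖ ≤ A) (hβ₂ : ∀ z, ‖β₂ z‖ ≤ B)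
    (h : ∀ z w : ℂ, f z - f w = ((z.re : ℂ) - w.re) * ⟪α₁ z, β₁ w⟫_ℂ +
      ((z.im : ℂ) - w.im) * ⟪α₂ z, β₂ w⟫_ℂ) (n : ℕ) :
    ∑ j ∈ Finset.range n, sNum (cfc f N₁ - cfc f N₂) j ≤
      104 * M * ∑ j ∈ Finset.range n, sNum (N₁ - N₂) j := by
  obtain ⟨u, v, hu, hv, huv⟩ := exists_isBessel_sum_sNum_le_four n (cfc f N₁ - cfc f N₂)
  have := norm_pairing_cfc_sub_le hN₁ hN₂ hf hA hB hM hα₁ hβ₁ hα₂ hβ₂ h hu hv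
  rw [pairing_apply] at this
  linarith

end Discretisation

section BandLimited

open scoped InnerProductSpace ContDiff SchwartzMap

theorem exists_schwartzMap_fourierInv_eq_one :
    ∃ K : 𝓢(ℝ, ℂ), ∀ u : ℝ, |u| < 2 → (𝓕⁻ K) u = 1 := by
  let b : ContDiffBump (0 : ℝ) := ⟨2, 3, by norm_num, by norm_num⟩
  have hs : HasCompactSupport fun x => (b x : ℂ) :=
    b.hasCompactSupport.comp_left (g := fun x : ℝ => (x : ℂ)) Complex.ofReal_zero
  have hd : ContDiff ℝ ∞ fun x => (b x : ℂ) := Complex.ofRealCLM.contDiff.comp b.contDiff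
  refine ⟨𝓕 (hs.toSchwartzMap hd), fun u hu => ?_⟩
  rw [FourierTransform.fourierInv_fourier_eq]
  change ((b u : ℝ) : ℂ) = 1
  rw [b.one_of_mem_closedBall (by simpa [b] using hu.le)]
  simp

theorem continuous_integral_mul_of_bounded {X : Type*} [TopologicalSpace X]
    [FirstCountableTopology X] {k : ℝ → ℂ} (hk : Integrable k) {F : X → ℝ → ℂ}
    (hF : Continuous (Function.uncurry F)) {C : ℝ} (hC : ∀ x r, ‖F x r‖ ≤ C) :
    Continuous fun x => ∫ r, k r * F x r := by
  refine continuous_of_dominated (bound := fun r => ‖k r‖ * C) (fun x => ?_) (fun x => ?_)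
    (hk.norm.mul_const C) ?_
  · exact hk.1.mul (hF.comp (Continuous.prodMk_right x)).aestronglyMeasurable
  · refine .of_forall fun r => ?_
    rw [norm_mul]
    exact mul_le_mul_of_nonneg_left (hC x r) (norm_nonneg _)
  · exact .of_forall fun r => continuous_const.mul (hF.comp (Continuous.prodMk_left r))

theorem integral_mul_integral_mul_swap {X : Type*} [TopologicalSpace X] [SecondCountableTopology X]
    [MeasurableSpace X] [BorelSpace X] {μ : Measure X} [SFinite μ]
    {k : ℝ → ℂ} (hk : Integrable k) {l : X → ℂ} (hl : Integrable l μ) {F : ℝ → X → ℂ}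
    (hF : Continuous (Function.uncurry F)) {C : ℝ} (hC : ∀ r x, ‖F r x‖ ≤ C) :
    ∫ r, k r * ∫ x, l x * F r x ∂μ = ∫ x, l x * (∫ r, k r * F r x) ∂μ := by
  have hprod : Integrable (Function.uncurry fun r x => k r * l x * F r x) (volume.prod μ) :=
    (hk.mul_prod hl).mul_bdd hF.aestronglyMeasurable (c := C)
      (.of_forall fun p => hC p.1 p.2)
  simp only [← integral_const_mul]
  have := integral_integral_swap hprod
  simpa only [mul_assoc, mul_left_comm] using this

theorem integral_mul_intervalIntegral_swap {k : ℝ → ℂ} (hk : Integrable k) {F : ℝ → ℝ → ℂ}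
    (hF : Continuous (Function.uncurry F)) {C : ℝ} (hC : ∀ r t, ‖F r t‖ ≤ C) (a b : ℝ) :
    ∫ r, k r * ∫ t in a..b, F r t = ∫ t in a..b, ∫ r, k r * F r t := by
  have : IsFiniteMeasure (volume.restrict (Set.uIoc a b)) :=
    isFiniteMeasure_restrict.2 measure_Ioc_lt_top.ne
  have hprod : Integrable (Function.uncurry fun t r => k r * F r t)
      ((volume.restrict (Set.uIoc a b)).prod volume) :=
    (hk.comp_snd _).mul_bdd (hF.comp continuous_swap).aestronglyMeasurable (c := C)
      (.of_forall fun p => hC p.2 p.1)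
  simp only [intervalIntegral_integral_swap hprod, intervalIntegral.integral_const_mul]

theorem fourier_mul_fourierInv_inner (K : 𝓢(ℝ, ℂ)) (χ : 𝓢(ℂ, ℂ)) (v x : ℂ) :
    𝓕 (fun ξ : ℂ => (𝓕⁻ K) ⟪v, ξ⟫_ℝ * χ ξ) x = ∫ r : ℝ, K r * (𝓕 (⇑χ)) (x - r • v) := by
  simp only [Real.fourier_eq', smul_eq_mul]
  have h := integral_mul_integral_mul_swap (μ := volume) K.integrable χ.integrable
    (F := fun r ξ => Complex.exp (↑(-2 * Real.pi * ⟪ξ, x - r • v⟫_ℝ) * Complex.I)) (by fun_prop)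
    (C := 1) (fun r ξ => by rw [Complex.norm_exp_ofReal_mul_I])
  have e : ∀ r : ℝ, ∫ ξ, Complex.exp (↑(-2 * Real.pi * ⟪ξ, x - r • v⟫_ℝ) * Complex.I) * χ ξ =
      ∫ ξ, χ ξ * Complex.exp (↑(-2 * Real.pi * ⟪ξ, x - r • v⟫_ℝ) * Complex.I) := fun r => by
    simp only [mul_comm]
  simp only [e, h]
  congr 1 with ξ
  rw [SchwartzMap.fourierInv_coe, Real.fourierInv_eq', ← mul_assoc,
    mul_comm _ (χ ξ)]
  congr 1
  rw [← integral_const_mul]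
  congr 1 with r
  rw [smul_eq_mul, ← mul_assoc, ← Complex.exp_add, mul_comm]
  congr 2
  rw [← add_mul, ← Complex.ofReal_add]
  congr 2
  simp only [inner_sub_right, inner_smul_right, real_inner_comm v ξ, RCLike.inner_apply,
    conj_trivial]
  ring

theorem integral_mul_integral_translate_swap (K : 𝓢(ℝ, ℂ)) (X : 𝓢(ℂ, ℂ)) {f : ℂ → ℂ}
    (hf : Continuous f) {C : ℝ} (hC : ∀ x, ‖f x‖ ≤ C) (v : ℂ) :
    ∫ x, f x * ∫ r, K r * X (x - r • v) = ∫ x, X x * ∫ r, K r * f (x + r • v) := by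
  have hX : Integrable (Function.uncurry fun (r : ℝ) (x : ℂ) => K r * X (x - r • v))
      (volume.prod volume) := by
    have hc : Continuous (Function.uncurry fun (r : ℝ) (x : ℂ) => K r * X (x - r • v)) :=
      (K.continuous.comp continuous_fst).mul (X.continuous.comp (by fun_prop))
    rw [integrable_prod_iff hc.aestronglyMeasurable]
    refine ⟨.of_forall fun r => (X.integrable.comp_sub_right (r • v)).const_mul (K r), ?_⟩
    simp only [Function.uncurry_apply_pair, norm_mul, integral_const_mul]
    simp only [fun r : ℝ => integral_sub_right_eq_self (μ := (volume : Measure ℂ))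
      (fun x => ‖X x‖) (r • v)]
    exact K.integrable.norm.mul_const _
  have hprod : Integrable (Function.uncurry fun (r : ℝ) (x : ℂ) => K r * X (x - r • v) * f x)
      (volume.prod volume) :=
    hX.mul_bdd (hf.comp continuous_snd).aestronglyMeasurable (c := C)
      (.of_forall fun p => hC p.2)
  calc ∫ x, f x * ∫ r, K r * X (x - r • v) = ∫ x, ∫ r, K r * X (x - r • v) * f x := by
        simp only [mul_comm (f _), ← integral_mul_const]
    _ = ∫ r, ∫ x, K r * X (x - r • v) * f x := (integral_integral_swap hprod).symm
    _ = ∫ r, K r * ∫ x, X x * f (x + r • v) := by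
        congr 1 with r
        simp only [mul_assoc, integral_const_mul]
        rw [← integral_add_right_eq_self (fun x => X (x - r • v) * f x) (r • v)]
        simp only [add_sub_cancel_right]
    _ = _ := integral_mul_integral_mul_swap K.integrable X.integrable
        (F := fun (r : ℝ) x => f (x + r • v)) (hf.comp (by fun_prop)) (fun r x => hC _)

theorem FourierSupportedIn.integral_mul_add_smul {f : ℂ → ℂ} {σ : ℝ} (hσ : FourierSupportedIn f σ)
    (hf : Continuous f) {C : ℝ} (hC : ∀ x, ‖f x‖ ≤ C) {K : 𝓢(ℝ, ℂ)}
    (hK : ∀ u : ℝ, |u| < 2 → (𝓕⁻ K) u = 1) {v : ℂ} (hv : ‖v‖ * σ ≤ 1) (x : ℂ) :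
    ∫ r : ℝ, K r * f (x + r • v) = f x := by
  have hcont : Continuous fun x => ∫ r : ℝ, K r * f (x + r • v) :=
    continuous_integral_mul_of_bounded K.integrable (F := fun x (r : ℝ) => f (x + r • v))
      (hf.comp (by fun_prop)) (fun x r => hC _)
  have hbd (x : ℂ) : ‖∫ r : ℝ, K r * f (x + r • v)‖ ≤ (∫ r, ‖K r‖) * C := by
    rw [← integral_mul_const]
    refine norm_integral_le_of_norm_le (K.integrable.norm.mul_const C) (.of_forall fun r => ?_)
    rw [norm_mul]
    exact mul_le_mul_of_nonneg_left (hC _) (norm_nonneg _)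
  have hL : (fun ξ : ℂ => (𝓕⁻ K) ⟪v, ξ⟫_ℝ).HasTemperateGrowth :=
    (𝓕⁻ K).hasTemperateGrowth.comp (innerSL ℝ v).hasTemperateGrowth
  suffices h : (fun x => f x - ∫ r : ℝ, K r * f (x + r • v)) =ᵐ[volume] fun _ => 0 by
    exact (sub_eq_zero.1 (congrFun
      ((Continuous.ae_eq_iff_eq volume (hf.sub hcont) continuous_const).1 h) x)).symm
  refine ae_eq_zero_of_integral_contDiff_smul_eq_zero
    (hf.sub hcont).locallyIntegrable fun g hg hgs => ?_
  have hs : HasCompactSupport fun x => (g x : ℂ) :=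
    hgs.comp_left (g := fun x : ℝ => (x : ℂ)) Complex.ofReal_zero
  let X : 𝓢(ℂ, ℂ) := hs.toSchwartzMap (Complex.ofRealCLM.contDiff.comp hg)
  let φ : 𝓢(ℂ, ℂ) := 𝓕⁻ X - SchwartzMap.smulLeftCLM ℂ (fun ξ : ℂ => (𝓕⁻ K) ⟪v, ξ⟫_ℝ) (𝓕⁻ X)
  have hU : IsOpen {ξ : ℂ | |⟪v, ξ⟫_ℝ| < 2} := isOpen_lt (by fun_prop) continuous_const
  have hφ : Disjoint (tsupport ⇑φ) (Metric.closedBall (0 : ℂ) σ) := by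
    have hsub : tsupport ⇑φ ⊆ {ξ : ℂ | |⟪v, ξ⟫_ℝ| < 2}ᶜ := by
      refine closure_minimal (fun ξ hξ h => hξ ?_) hU.isClosed_compl
      rw [sub_apply, SchwartzMap.smulLeftCLM_apply_apply hL, hK _ h, one_smul,
        sub_self]
    refine (Set.disjoint_compl_left_iff_subset.2 fun ξ hξ => ?_).mono_left hsub
    have : |⟪v, ξ⟫_ℝ| ≤ ‖v‖ * σ := (abs_real_inner_le_norm v ξ).trans
      (mul_le_mul_of_nonneg_left (by simpa using hξ) (norm_nonneg _))
    exact lt_of_le_of_lt (this.trans hv) one_lt_two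
  have hF (x : ℂ) : 𝓕 (⇑φ) x = X x - ∫ r : ℝ, K r * X (x - r • v) := by
    have e := fourier_mul_fourierInv_inner K (𝓕⁻ X) v x
    have eX : 𝓕 (⇑(𝓕⁻ X : 𝓢(ℂ, ℂ))) = ⇑X := by
      rw [← SchwartzMap.fourier_coe, FourierTransform.fourier_fourierInv_eq]
    rw [eX] at e
    rw [← e, ← SchwartzMap.fourier_coe]
    have : 𝓕 φ = X - 𝓕 (SchwartzMap.smulLeftCLM ℂ (fun ξ : ℂ => (𝓕⁻ K) ⟪v, ξ⟫_ℝ) (𝓕⁻ X)) := by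
      refine (map_sub (FourierTransform.fourierCLE ℂ 𝓢(ℂ, ℂ)) (𝓕⁻ X) _).trans ?_
      simp only [FourierTransform.fourierCLE_apply, FourierTransform.fourier_fourierInv_eq]
    rw [this, sub_apply, SchwartzMap.fourier_coe, SchwartzMap.smulLeftCLM_apply hL]
    rfl
  have hi : Integrable fun x => X x * f x :=
    X.integrable.mul_bdd hf.aestronglyMeasurable (.of_forall hC)
  have hi' : Integrable fun x => X x * ∫ r : ℝ, K r * f (x + r • v) :=
    X.integrable.mul_bdd hcont.aestronglyMeasurable (.of_forall hbd)
  have hi'' : Integrable fun x => f x * 𝓕 (⇑φ) x :=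
    (SchwartzMap.integrable (𝓕 φ)).bdd_mul hf.aestronglyMeasurable (.of_forall hC)
  calc ∫ x, g x • (f x - ∫ r : ℝ, K r * f (x + r • v))
      = ∫ x, (X x * f x - X x * ∫ r : ℝ, K r * f (x + r • v)) := by
        congr 1 with x
        rw [Complex.real_smul, mul_sub]
        rfl
    _ = (∫ x, X x * f x) - ∫ x, f x * ∫ r, K r * X (x - r • v) := by
        rw [integral_sub hi hi', integral_mul_integral_translate_swap K X hf hC]
    _ = (∫ x, X x * f x) - ∫ x, (X x * f x - f x * 𝓕 (⇑φ) x) := by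
        simp only [hF, mul_sub, mul_comm (X _), sub_sub_cancel]
    _ = 0 := by rw [integral_sub hi hi'', hσ φ hφ, sub_zero, sub_self]

theorem memLp_two_inv_sqrt_one_add_sq : MemLp (fun t : ℝ => (√(1 + t ^ 2))⁻¹) 2 := by
  have hc : Continuous fun t : ℝ => (√(1 + t ^ 2))⁻¹ :=
    (by fun_prop : Continuous fun t : ℝ => √(1 + t ^ 2)).inv₀ fun t => by positivity
  rw [memLp_two_iff_integrable_sq hc.aestronglyMeasurable]
  refine integrable_inv_one_add_sq.congr (.of_forall fun t => ?_)
  simp only [inv_pow]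
  rw [Real.sq_sqrt (by positivity)]

/-- `h` is continuous, bounded by `C`, and reproduced by convolution with all dilates
of `K` by factors in `[-1, 1]`. -/
structure IsReproduced (K : 𝓢(ℝ, ℂ)) (h : ℝ → ℂ) (C : ℝ) : Prop where
  cont : Continuous h
  norm_le : ∀ t, ‖h t‖ ≤ C
  integral_eq : ∀ s : ℝ, |s| ≤ 1 → ∀ t, ∫ r, K r * h (t + s * r) = h t

namespace IsReproduced

variable {K : 𝓢(ℝ, ℂ)} {h : ℝ → ℂ} {C : ℝ}

theorem norm_integral_mul_le (hh : IsReproduced K h C) (k : 𝓢(ℝ, ℂ)) (t : ℝ) :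
    ‖∫ r, k r * h (t + r)‖ ≤ (∫ r, ‖k r‖) * C := by
  rw [← integral_mul_const]
  refine norm_integral_le_of_norm_le (k.integrable.norm.mul_const C) (.of_forall fun r => ?_)
  rw [norm_mul]
  exact mul_le_mul_of_nonneg_left (hh.norm_le _) (norm_nonneg _)

theorem integral_mul (hh : IsReproduced K h C) (k : 𝓢(ℝ, ℂ)) :
    IsReproduced K (fun t => ∫ r, k r * h (t + r)) ((∫ r, ‖k r‖) * C) where
  cont := continuous_integral_mul_of_bounded k.integrable (F := fun t r => h (t + r))
    (hh.cont.comp (by fun_prop)) (fun _ _ => hh.norm_le _)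
  norm_le := hh.norm_integral_mul_le k
  integral_eq s hs t := by
    rw [integral_mul_integral_mul_swap K.integrable k.integrable
      (F := fun r u => h (t + s * r + u)) (hh.cont.comp (by fun_prop)) (fun _ _ => hh.norm_le _)]
    congr 1 with u
    rw [← hh.integral_eq s hs (t + u)]
    simp only [add_right_comm]

theorem sub_eq_integral (hh : IsReproduced K h C) (x y : ℝ) :
    h y - h x = ∫ t in x..y, ∫ r, (-SchwartzMap.derivCLM ℂ ℂ K) r * h (t + r) := by
  have hi (a b : ℝ) : IntervalIntegrable h volume a b := hh.cont.intervalIntegrable a b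
  have hd (r : ℝ) : HasDerivAt (fun r => ∫ t in x..y, h (t + r)) (h (y + r) - h (x + r)) r := by
    have h1 (c : ℝ) : HasDerivAt (fun r => ∫ t in (0 : ℝ)..(c + r), h t) (h (c + r)) r := by
      have := intervalIntegral.integral_hasDerivAt_right (hi 0 (c + r))
        hh.cont.stronglyMeasurable.stronglyMeasurableAtFilter hh.cont.continuousAt
      exact this.comp_const_add c r
    refine ((h1 y).sub (h1 x)).congr_of_eventuallyEq (.of_forall fun r => ?_)
    simp only [Pi.sub_apply]
    rw [intervalIntegral.integral_comp_add_right, intervalIntegral.integral_interval_sub_left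
      (hi _ _) (hi _ _)]
  have hb (r : ℝ) : ‖∫ t in x..y, h (t + r)‖ ≤ C * |y - x| :=
    intervalIntegral.norm_integral_le_of_norm_le_const fun t _ => hh.norm_le _
  have hc : Continuous fun r => ∫ t in x..y, h (t + r) :=
    continuous_iff_continuousAt.2 fun r => (hd r).continuousAt
  have hb' (r : ℝ) : ‖h (y + r) - h (x + r)‖ ≤ C + C :=
    (norm_sub_le _ _).trans (add_le_add (hh.norm_le _) (hh.norm_le _))
  have hc' : Continuous fun r => h (y + r) - h (x + r) :=
    (hh.cont.comp (by fun_prop)).sub (hh.cont.comp (by fun_prop))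
  have parts := integral_mul_deriv_eq_deriv_mul_of_integrable
    (u := K) (u' := SchwartzMap.derivCLM ℂ ℂ K) (v := fun r => ∫ t in x..y, h (t + r))
    (fun r _ => K.hasDerivAt r) (fun r _ => hd r)
    (K.integrable.mul_bdd hc'.aestronglyMeasurable (.of_forall hb'))
    ((SchwartzMap.derivCLM ℂ ℂ K).integrable.mul_bdd hc.aestronglyMeasurable (.of_forall hb))
    (K.integrable.mul_bdd hc.aestronglyMeasurable (.of_forall hb))
  have h0 (c : ℝ) : ∫ r, K r * h (c + r) = h c := by simpa using hh.integral_eq 1 (by simp) c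
  have hK (c : ℝ) : Integrable fun r => K r * h (c + r) :=
    K.integrable.mul_bdd (hh.cont.comp (by fun_prop)).aestronglyMeasurable
      (.of_forall fun _ => hh.norm_le _)
  rw [← integral_mul_intervalIntegral_swap (-SchwartzMap.derivCLM ℂ ℂ K).integrable
    (F := fun r t => h (t + r)) (hh.cont.comp (by fun_prop)) (fun _ _ => hh.norm_le _)]
  simp only [neg_apply, neg_mul, integral_neg, ← parts, mul_sub]
  rw [integral_sub (hK y) (hK x), h0, h0]

/-- The divided difference of a reproduced function, based at `x`. -/
theorem exists_dividedDifference (hh : IsReproduced K h C) (x : ℝ) :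
    ∃ q : ℝ → ℂ, Continuous q ∧ (∀ t, ‖q t‖ ≤ (∫ r, ‖SchwartzMap.derivCLM ℂ ℂ K r‖) * C) ∧
      (∀ t, h t - h x = (t - x) * q t) ∧ ∀ t, ∫ r, K r * q (t + r) = q t := by
  set G : ℝ → ℂ := fun t => ∫ r, (-SchwartzMap.derivCLM ℂ ℂ K) r * h (t + r) with hG
  have hGr : IsReproduced K G ((∫ r, ‖SchwartzMap.derivCLM ℂ ℂ K r‖) * C) := by
    have := hh.integral_mul (-SchwartzMap.derivCLM ℂ ℂ K)
    rwa [show (∫ r, ‖(-SchwartzMap.derivCLM ℂ ℂ K) r‖) = ∫ r, ‖SchwartzMap.derivCLM ℂ ℂ K r‖ by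
      simp only [neg_apply, norm_neg]] at this
  have hcont : Continuous fun p : ℝ × ℝ => G (x + p.2 * (p.1 - x)) :=
    hGr.cont.comp (by fun_prop)
  refine ⟨fun t => ∫ τ in (0 : ℝ)..1, G (x + τ * (t - x)), ?_, fun t => ?_, fun t => ?_,
    fun t => ?_⟩
  · exact intervalIntegral.continuous_parametric_intervalIntegral_of_continuous' hcont 0 1
  · simpa using intervalIntegral.norm_integral_le_of_norm_le_const (a := 0) (b := 1)
      fun τ _ => hGr.norm_le (x + τ * (t - x))
  · rw [hh.sub_eq_integral x t]
    have := intervalIntegral.smul_integral_comp_add_mul (a := 0) (b := 1) G (t - x) x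
    simp only [mul_comm _ (t - x)]
    rw [← Complex.ofReal_sub, ← Complex.real_smul, this]
    simp [hG]
  · rw [integral_mul_intervalIntegral_swap K.integrable
      (F := fun r τ => G (x + τ * (t + r - x))) (hGr.cont.comp (by fun_prop))
      (fun _ _ => hGr.norm_le _)]
    refine intervalIntegral.integral_congr fun τ hτ => ?_
    rw [Set.uIcc_of_le zero_le_one] at hτ
    rw [← hGr.integral_eq τ (abs_le.2 ⟨by linarith [hτ.1], hτ.2⟩)]
    congr 1 with r
    ring_nf

theorem exists_memLp_dividedDifference (hh : IsReproduced K h C) (hC : 0 ≤ C) (x : ℝ) :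
    ∃ q : ℝ → ℂ, MemLp q 2 ∧
      eLpNorm q 2 volume ≤ ENNReal.ofReal (((∫ r, ‖SchwartzMap.derivCLM ℂ ℂ K r‖) + 2) * C) *
        eLpNorm (fun t : ℝ => (√(1 + t ^ 2))⁻¹) 2 volume ∧
      ∀ y, h y - h x = (y - x) * ∫ t, K (t - y) * q t := by
  obtain ⟨q, hqc, hqb, hq, hqr⟩ := hh.exists_dividedDifference x
  set D := ∫ r, ‖SchwartzMap.derivCLM ℂ ℂ K r‖
  have hD : 0 ≤ D := integral_nonneg fun r => norm_nonneg _
  have hq2 (t : ℝ) : |t - x| * ‖q t‖ ≤ 2 * C := by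
    have e : ‖h t - h x‖ = |t - x| * ‖q t‖ := by
      rw [hq t, norm_mul, ← Complex.ofReal_sub, Complex.norm_real, Real.norm_eq_abs]
    rw [← e]
    exact (norm_sub_le _ _).trans (by linarith [hh.norm_le t, hh.norm_le x])
  have hle (t : ℝ) : ‖q t‖ ≤ (D + 2) * C * ‖(√(1 + (t - x) ^ 2))⁻¹‖ := by
    have hs : 0 < √(1 + (t - x) ^ 2) := Real.sqrt_pos.2 (by positivity)
    rw [Real.norm_of_nonneg (inv_nonneg.2 hs.le), ← div_eq_mul_inv, le_div_iff₀ hs]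
    refine abs_le_of_sq_le_sq' ?_ (by positivity) |>.2
    rw [mul_pow, Real.sq_sqrt (by positivity)]
    have h1 := pow_le_pow_left₀ (norm_nonneg _) (hqb t) 2
    have h2 := pow_le_pow_left₀ (by positivity) (hq2 t) 2
    rw [mul_pow, sq_abs] at h2
    nlinarith [mul_nonneg hD (sq_nonneg C)]
  have hw := memLp_two_inv_sqrt_one_add_sq.comp_measurePreserving
    (measurePreserving_sub_right volume x)
  have hwn := eLpNorm_comp_measurePreserving (p := 2) memLp_two_inv_sqrt_one_add_sq.1
    (measurePreserving_sub_right volume x)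
  refine ⟨q, hw.of_le_mul hqc.aestronglyMeasurable (.of_forall hle), ?_, fun y => ?_⟩
  · rw [← hwn]
    exact eLpNorm_le_mul_eLpNorm_of_ae_le_mul (.of_forall hle) 2
  · rw [hq y, ← hqr y, ← integral_sub_right_eq_self (fun r => K r * q (y + r)) y]
    simp only [add_sub_cancel]

end IsReproduced

theorem inner_toLp_star {u v : ℝ → ℂ} (hu : MemLp u 2) (hv : MemLp v 2) :
    ⟪hu.star.toLp _, hv.toLp v⟫_ℂ = ∫ t, u t * v t := by
  rw [L2.inner_def]
  refine integral_congr_ae ?_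
  filter_upwards [hu.star.coeFn_toLp, hv.coeFn_toLp] with t h1 h2
  rw [h1, h2]
  simp [mul_comm]

theorem norm_toLp_star {u : ℝ → ℂ} (hu : MemLp u 2) : ‖hu.star.toLp _‖ = ‖hu.toLp u‖ := by
  rw [Lp.norm_toLp, Lp.norm_toLp]
  exact congrArg _ (eLpNorm_congr_norm_ae (.of_forall fun t => norm_star (u t)))

theorem exists_lp_dividedDifference (K : 𝓢(ℝ, ℂ)) :
    ∃ (c : ℝ) (k k' : ℝ → Lp ℂ 2 (volume : Measure ℝ)), 0 ≤ c ∧ (∀ y, ‖k y‖ ≤ c) ∧ (∀ y, ‖k' y‖ ≤ c) ∧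
      ∀ h : ℝ → ℂ, IsReproduced K h 1 → ∀ x, ∃ Q Q' : Lp ℂ 2 (volume : Measure ℝ), ‖Q‖ ≤ c ∧ ‖Q'‖ ≤ c ∧
        ∀ y, h y - h x = (y - x) * ⟪k' y, Q⟫_ℂ ∧ h y - h x = (y - x) * ⟪Q', k y⟫_ℂ := by
  have hK : MemLp (⇑K) 2 := K.memLp 2 volume
  have hKy (y : ℝ) : MemLp (fun t => K (t - y)) 2 :=
    hK.comp_measurePreserving (measurePreserving_sub_right volume y)
  have hKn (y : ℝ) : ‖(hKy y).toLp _‖ = ‖hK.toLp _‖ := by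
    rw [Lp.norm_toLp, Lp.norm_toLp]
    exact congrArg _ (eLpNorm_comp_measurePreserving hK.1 (measurePreserving_sub_right volume y))
  set D := (∫ r, ‖SchwartzMap.derivCLM ℂ ℂ K r‖) + 2
  have hD : 0 ≤ D := add_nonneg (integral_nonneg fun r => norm_nonneg _) zero_le_two
  set W := (eLpNorm (fun t : ℝ => (√(1 + t ^ 2))⁻¹) 2 volume).toReal
  refine ⟨max ‖hK.toLp _‖ (D * W), fun y => (hKy y).toLp _, fun y => (hKy y).star.toLp _,
    le_max_of_le_left (norm_nonneg _), fun y => (hKn y).le.trans (le_max_left _ _),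
    fun y => (norm_toLp_star (hKy y)).le.trans ((hKn y).le.trans (le_max_left _ _)),
    fun h hh x => ?_⟩
  obtain ⟨q, hq, hqn, hqy⟩ := hh.exists_memLp_dividedDifference zero_le_one x
  have hn : ‖hq.toLp q‖ ≤ max ‖hK.toLp _‖ (D * W) := by
    refine le_max_of_le_right ?_
    rw [Lp.norm_toLp]
    refine (ENNReal.toReal_mono (ENNReal.mul_ne_top ENNReal.ofReal_ne_top
      memLp_two_inv_sqrt_one_add_sq.2.ne) hqn).trans ?_
    rw [ENNReal.toReal_mul, ENNReal.toReal_ofReal (by positivity), mul_one]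
  refine ⟨hq.toLp q, hq.star.toLp _, hn, (norm_toLp_star hq).le.trans hn, fun y => ⟨?_, ?_⟩⟩
  · rw [inner_toLp_star (hKy y) hq, hqy y]
  · rw [inner_toLp_star hq (hKy y), hqy y]
    simp only [mul_comm (q _)]

theorem isReproduced_line {f : ℂ → ℂ} {σ : ℝ} (hσ0 : 0 < σ) (hσ : FourierSupportedIn f σ)
    (hf : Continuous f) {C : ℝ} (hC : ∀ x, ‖f x‖ ≤ C) {K : 𝓢(ℝ, ℂ)}
    (hK : ∀ u : ℝ, |u| < 2 → (𝓕⁻ K) u = 1) (z : ℂ) {v : ℂ} (hv : ‖v‖ = 1) :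
    IsReproduced K (fun t => (C : ℂ)⁻¹ * f (z + (t / σ) • v)) 1 where
  cont := continuous_const.mul (hf.comp (by fun_prop))
  norm_le t := by
    have hC0 : 0 ≤ C := (norm_nonneg _).trans (hC 0)
    rw [norm_mul, norm_inv, Complex.norm_real, Real.norm_of_nonneg hC0, ← div_eq_inv_mul]
    exact div_le_one_of_le₀ (hC _) hC0
  integral_eq s hs t := by
    simp only [mul_left_comm _ (C : ℂ)⁻¹, integral_const_mul]
    congr 1
    rw [← hσ.integral_mul_add_smul hf hC hK (v := (s / σ) • v)]
    · congr 1 with r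
      congr 2
      rw [smul_smul, add_assoc, ← add_smul]
      congr 2
      ring
    · rw [norm_smul, hv, mul_one, norm_div, Real.norm_of_nonneg hσ0.le,
        div_mul_cancel₀ _ hσ0.ne']
      exact hs

/-- A band-limited function has divided differences that factor through a Hilbert space. -/
theorem exists_dividedDifference_factorization :
    ∃ c : ℝ, 0 ≤ c ∧ ∀ σ : ℝ, 0 < σ → ∀ f : BoundedContinuousFunction ℂ ℂ,
      FourierSupportedIn f σ → ∃ α₁ β₁ α₂ β₂ : ℂ → Lp ℂ 2 (volume : Measure ℝ),
        (∀ z, ‖α₁ z‖ ≤ c) ∧ (∀ z, ‖β₁ z‖ ≤ c * σ * ‖f‖) ∧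
        (∀ z, ‖α₂ z‖ ≤ c) ∧ (∀ z, ‖β₂ z‖ ≤ c * σ * ‖f‖) ∧
        ∀ z w, f z - f w = ((z.re : ℂ) - w.re) * ⟪α₁ z, β₁ w⟫_ℂ +
          ((z.im : ℂ) - w.im) * ⟪α₂ z, β₂ w⟫_ℂ := by
  obtain ⟨K, hK⟩ := exists_schwartzMap_fourierInv_eq_one
  obtain ⟨c, k, k', hc, hk, hk', H⟩ := exists_lp_dividedDifference K
  refine ⟨c, hc, fun σ hσ0 f hσ => ?_⟩
  have hr (z : ℂ) {v : ℂ} (hv : ‖v‖ = 1) :=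
    isReproduced_line hσ0 hσ f.continuous f.norm_coe_le_norm hK z hv
  have hf (z : ℂ) : (‖f‖ : ℂ) * ((‖f‖ : ℂ)⁻¹ * f z) = f z := by
    rcases eq_or_ne f 0 with rfl | h
    · simp
    · rw [mul_inv_cancel_left₀ (by simpa using h)]
  have hσc : (σ : ℂ) ≠ 0 := by exact_mod_cast hσ0.ne'
  choose Q Q' hQ hQ' hQy using fun (z : ℂ) (x : ℝ) => H _ (hr z (v := Complex.I) (by simp)) x
  choose P P' hP hP' hPy using fun (z : ℂ) (x : ℝ) => H _ (hr z (v := 1) (by simp)) x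
  have hnorm {u : Lp ℂ 2 (volume : Measure ℝ)} (hu : ‖u‖ ≤ c) : ‖((σ * ‖f‖ : ℝ) : ℂ) • u‖ ≤ c * σ * ‖f‖ := by
    rw [norm_smul, Complex.norm_real, Real.norm_of_nonneg (by positivity), mul_assoc c, mul_comm c]
    exact mul_le_mul_of_nonneg_left hu (by positivity)
  refine ⟨fun z => P' (z.im • Complex.I) (σ * z.re), fun w => ((σ * ‖f‖ : ℝ) : ℂ) • k (σ * w.re),
    fun z => k' (σ * z.im), fun w => ((σ * ‖f‖ : ℝ) : ℂ) • Q w.re (σ * w.im),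
    fun z => hP' _ _, fun w => hnorm (hk _), fun z => hk' _, fun w => hnorm (hQ _ _),
    fun z w => ?_⟩
  have h1 := (hPy (z.im • Complex.I) (σ * z.re) (σ * w.re)).2
  have h2 := (hQy w.re (σ * w.im) (σ * z.im)).1
  simp only [mul_div_cancel_left₀ _ hσ0.ne'] at h1 h2
  have e (x y : ℝ) : (y • Complex.I + x • (1 : ℂ)) = x + y • Complex.I := by simp [add_comm]
  have e' (u : ℂ) : (u.re : ℂ) + u.im • Complex.I = u := by simp [Complex.re_add_im]
  rw [e, e, e'] at h1
  rw [e'] at h2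
  rw [inner_smul_right, inner_smul_right, ← hf z, ← hf w]
  push_cast at h1 h2 ⊢
  linear_combination (-(‖f‖ : ℂ)) * h1 + (‖f‖ : ℂ) * h2

end BandLimited

/-- There is an absolute constant `C > 0` such that for every `σ > 0`, every `1 ≤ p < ∞`,
every bounded continuous `f : ℂ → ℂ` with Fourier transform supported in the closed disc of
radius `σ`, and all bounded normal operators `N₁, N₂` with `N₁ - N₂ ∈ S_p`, the operator
`f(N₁) - f(N₂)` is in `S_p` and `‖f(N₁) - f(N₂)‖_{S_p} ≤ C σ ‖f‖_∞ ‖N₁ - N₂‖_{S_p}`. -/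
theorem key_inequality_band_limited_schatten :
    ∃ C : ℝ, 0 < C ∧
      ∀ (σ : ℝ), 0 < σ →
      ∀ (p : ℝ), 1 ≤ p →
      ∀ f : BoundedContinuousFunction ℂ ℂ, FourierSupportedIn (⇑f) σ →
      ∀ (H : Type*) [NormedAddCommGroup H] [InnerProductSpace ℂ H] [CompleteSpace H]
        (N₁ N₂ : H →L[ℂ] H), IsStarNormal N₁ → IsStarNormal N₂ →
        MemSchatten p (N₁ - N₂) →
        MemSchatten p (cfc (⇑f) N₁ - cfc (⇑f) N₂) ∧
          schattenNorm p (cfc (⇑f) N₁ - cfc (⇑f) N₂) ≤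
            C * σ * ‖f‖ * schattenNorm p (N₁ - N₂) := by
  obtain ⟨c, hc, hfac⟩ := exists_dividedDifference_factorization
  refine ⟨104 * (c * c) + 1, by positivity, fun σ hσ0 p hp f hσ H _ _ _ N₁ N₂ hN₁ hN₂ hS => ?_⟩
  obtain ⟨α₁, β₁, α₂, β₂, hα₁, hβ₁, hα₂, hβ₂, h⟩ := hfac σ hσ0 f hσ
  have hle : 104 * (c * (c * σ * ‖f‖)) ≤ (104 * (c * c) + 1) * σ * ‖f‖ := by
    have : 0 ≤ σ * ‖f‖ := by positivity
    linarith
  refine summable_rpow_of_weak_majorization hp (by positivity) (sNum_nonneg _) (sNum_nonneg _)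
    (sNum_antitone _) (fun n => ?_) hS
  refine (sum_sNum_cfc_sub_le hN₁ hN₂ f.continuous hc (by positivity) le_rfl hα₁ hβ₁ hα₂ hβ₂ h
    n).trans ?_
  exact mul_le_mul_of_nonneg_right hle (Finset.sum_nonneg fun j _ => sNum_nonneg _ j)
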